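/- Let (H,R) be a finite-dimensional semisimple and cosemisimple quasi-triangular Hopf algebra over a field k, D a minimal H-adjoint-stable subcoalgebra of H_R, and W a finite-dimensional nonzero left D-comodule. Then for every finite-dimensional V ∈ _H^D M one has dim_k(W* □_D V) · dim_k D = dim_k V · dim_k W. In particular, for finite-dimensional left D-comodules W and W′, dim_k N_{WW′} · dim_k D = dim_k H · dim_k W · dim_k W′, where N_{WW′} = W* □_D (H⊗W′). -/

import Mathlib

open TensorProduct LinearMap

variable (K : Type) [Field K] (H : Type) [Ring H] [HopfAlgebra K H]

/-- The left adjoint action as a linear map `H ⊗ H →ₗ H`, `h ⊗ a ↦ Σ h₍₁₎ * a * S(h₍₂₎)`. -/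
noncomputable def adMap : H ⊗[K] H →ₗ[K] H :=
  (LinearMap.mul' K H) ∘ₗ
    (LinearMap.lTensor H ((LinearMap.mul' K H) ∘ₗ
      (LinearMap.lTensor H (HopfAlgebra.antipode (R := K))) ∘ₗ
      (TensorProduct.comm K H H).toLinearMap)) ∘ₗ
    (TensorProduct.assoc K H H H).toLinearMap ∘ₗ
    (LinearMap.rTensor H (Coalgebra.comul (R := K)))

/-- `h ·_ad a = Σ h₍₁₎ a S(h₍₂₎)`. -/
noncomputable def adAct (h a : H) : H := adMap K H (h ⊗ₜ a)

/-- `R¹² = Σ r¹ ⊗ r² ⊗ 1` in `H ⊗ (H ⊗ H)`. -/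
noncomputable def r12 (R : H ⊗[K] H) : H ⊗[K] (H ⊗[K] H) :=
  TensorProduct.map LinearMap.id ((TensorProduct.mk K H H).flip 1) R

/-- `R¹³ = Σ r¹ ⊗ 1 ⊗ r²` in `H ⊗ (H ⊗ H)`. -/
noncomputable def r13 (R : H ⊗[K] H) : H ⊗[K] (H ⊗[K] H) :=
  TensorProduct.map LinearMap.id (TensorProduct.mk K H H 1) R

/-- `R²³ = 1 ⊗ R` in `H ⊗ (H ⊗ H)`. -/
noncomputable def r23 (R : H ⊗[K] H) : H ⊗[K] (H ⊗[K] H) := (1 : H) ⊗ₜ R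

/-- `(H,R)` is a quasi-triangular Hopf algebra: `R` is invertible,
`R Δ(h) = Δᶜᵒᵖ(h) R`, `(Δ⊗id)(R) = R¹³R²³` and `(id⊗Δ)(R) = R¹³R¹²`. -/
structure IsQuasiTriangular (R : H ⊗[K] H) : Prop where
  isUnit : IsUnit R
  intertwine : ∀ h : H, R * Coalgebra.comul h =
    (TensorProduct.comm K H H) (Coalgebra.comul h) * R
  comul_rTensor : (TensorProduct.assoc K H H H)
      ((LinearMap.rTensor H (Coalgebra.comul (R := K))) R) = r13 K H R * r23 K H R
  comul_lTensor : (LinearMap.lTensor H (Coalgebra.comul (R := K))) R = r13 K H R * r12 K H R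

/-- The comultiplication `Δ_R` of the transmuted braided group `H_R`:
`Δ_R(h) = Σ h₍₁₎ S(R²) ⊗ R¹ ·_ad h₍₂₎`. -/
noncomputable def deltaR (R : H ⊗[K] H) : H →ₗ[K] H ⊗[K] H :=
  (TensorProduct.map
      ((LinearMap.mul' K H) ∘ₗ (LinearMap.lTensor H (HopfAlgebra.antipode (R := K))))
      ((adMap K H) ∘ₗ (TensorProduct.comm K H H).toLinearMap)) ∘ₗ
    (TensorProduct.tensorTensorTensorComm K H H H H).toLinearMap ∘ₗ
    (LinearMap.lTensor (H ⊗[K] H) (TensorProduct.comm K H H).toLinearMap) ∘ₗ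
    ((TensorProduct.mk K (H ⊗[K] H) (H ⊗[K] H)).flip R) ∘ₗ
    (Coalgebra.comul (R := K))

/-- A subcoalgebra of `(H, Δ)`. -/
def IsSubcoalgebra (D : Submodule K H) : Prop :=
  ∀ a ∈ D, Coalgebra.comul (R := K) a ∈ Submodule.map₂ (TensorProduct.mk K H H) D D

/-- A simple (nonzero, minimal) subcoalgebra of `(H, Δ)`. -/
def IsSimpleSubcoalgebra (D : Submodule K H) : Prop :=
  D ≠ ⊥ ∧ IsSubcoalgebra K H D ∧
    ∀ D' : Submodule K H, D' ≤ D → IsSubcoalgebra K H D' → D' = ⊥ ∨ D' = D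

/-- `H` is a cosemisimple coalgebra: the sum of its simple subcoalgebras is everything. -/
def IsCosemisimpleCoalgebra : Prop :=
  sSup {D : Submodule K H | IsSimpleSubcoalgebra K H D} = ⊤

/-- A subcoalgebra of the transmuted braided group `(H, Δ_R)`. -/
def IsSubcoalgebraR (R : H ⊗[K] H) (D : Submodule K H) : Prop :=
  ∀ a ∈ D, deltaR K H R a ∈ Submodule.map₂ (TensorProduct.mk K H H) D D

/-- A simple (nonzero, minimal) subcoalgebra of `(H, Δ_R)`. -/
def IsSimpleSubcoalgebraR (R : H ⊗[K] H) (D : Submodule K H) : Prop :=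
  D ≠ ⊥ ∧ IsSubcoalgebraR K H R D ∧
    ∀ D' : Submodule K H, D' ≤ D → IsSubcoalgebraR K H R D' → D' = ⊥ ∨ D' = D

/-- The coalgebra `(H, Δ_R)` is cosemisimple: it is the sum of its simple subcoalgebras. -/
def IsCosemisimpleR (R : H ⊗[K] H) : Prop :=
  sSup {D : Submodule K H | IsSimpleSubcoalgebraR K H R D} = ⊤

/-- A Yetter–Drinfeld submodule of `H` (with the adjoint action and the coproduct):
a subspace stable under `·_ad` and a left subcomodule for `Δ`, i.e. `Δ(D) ⊆ H ⊗ D`. -/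
def IsYDSubmodule (D : Submodule K H) : Prop :=
  (∀ (h : H), ∀ a ∈ D, adAct K H h a ∈ D) ∧
  (∀ a ∈ D, Coalgebra.comul (R := K) a ∈ Submodule.map₂ (TensorProduct.mk K H H) ⊤ D)

/-- A minimal (irreducible) Yetter–Drinfeld submodule of `H`. -/
def IsMinimalYDSubmodule (D : Submodule K H) : Prop :=
  D ≠ ⊥ ∧ IsYDSubmodule K H D ∧
    ∀ D' : Submodule K H, D' ≤ D → IsYDSubmodule K H D' → D' = ⊥ ∨ D' = D

/-- An `H`-adjoint-stable subcoalgebra of the transmuted braided group `H_R`: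
a subcoalgebra of `(H, Δ_R)` which is stable under the left adjoint action. -/
def IsAdjointStableSubcoalgebra (R : H ⊗[K] H) (D : Submodule K H) : Prop :=
  (∀ (h : H), ∀ a ∈ D, adAct K H h a ∈ D) ∧
  (∀ a ∈ D, deltaR K H R a ∈ Submodule.map₂ (TensorProduct.mk K H H) D D)

/-- A minimal (nonzero) `H`-adjoint-stable subcoalgebra of `H_R`. -/
def IsMinimalAdjointStableSubcoalgebra (R : H ⊗[K] H) (D : Submodule K H) : Prop :=
  D ≠ ⊥ ∧ IsAdjointStableSubcoalgebra K H R D ∧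
    ∀ D' : Submodule K H, D' ≤ D → IsAdjointStableSubcoalgebra K H R D' → D' = ⊥ ∨ D' = D

/-- An object of `_H^{H_R}M`: a left `H`-module `V` together with a left comodule
structure `ρ_R` over the transmuted braided group `(H, Δ_R)`, satisfying the
compatibility `ρ_R(hv) = Σ h₍₁₎ ·_ad v⁽⁻¹⁾ ⊗ h₍₂₎ v⁽⁰⁾`.  By Zhu's lemma, this
category is the Yetter–Drinfeld category `_H^H YD`. -/
structure RModStr (R : H ⊗[K] H) (V : Type*) [AddCommGroup V] [Module K V] where
  act : H →ₐ[K] Module.End K V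
  coact : V →ₗ[K] H ⊗[K] V
  counit_coact : ∀ v : V,
    (TensorProduct.lid K V)
      ((LinearMap.rTensor V (Coalgebra.counit (R := K))) (coact v)) = v
  coassocR : (LinearMap.rTensor V (deltaR K H R)) ∘ₗ coact
      = (TensorProduct.assoc K H H V).symm.toLinearMap ∘ₗ
        (LinearMap.lTensor H coact) ∘ₗ coact
  compat : coact ∘ₗ (TensorProduct.lift act.toLinearMap)
      = (TensorProduct.map (adMap K H) (TensorProduct.lift act.toLinearMap)) ∘ₗ
        (TensorProduct.tensorTensorTensorComm K H H H V).toLinearMap ∘ₗ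
        (TensorProduct.map (Coalgebra.comul (R := K)) coact)

/-- The object lies in the subcategory `_H^D M`: its coaction takes values in `D ⊗ V`. -/
def memDCat (R : H ⊗[K] H) (D : Submodule K H) {V : Type*} [AddCommGroup V]
    [Module K V] (s : RModStr K H R V) : Prop :=
  ∀ v : V, s.coact v ∈ Submodule.map₂ (TensorProduct.mk K H V) D ⊤

/-- Irreducibility of an object of `_H^{H_R}M = _H^H YD`: it is nonzero and has no
nontrivial subspace stable under the action and the coaction. -/
def RModIrreducible (R : H ⊗[K] H) {V : Type*} [AddCommGroup V] [Module K V]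
    (s : RModStr K H R V) : Prop :=
  (⊥ : Submodule K V) ≠ ⊤ ∧
    ∀ W : Submodule K V, (∀ h : H, ∀ w ∈ W, s.act h w ∈ W) →
      (∀ w ∈ W, s.coact w ∈ Submodule.map₂ (TensorProduct.mk K H V) ⊤ W) →
      W = ⊥ ∨ W = ⊤

/-- A left comodule structure over a subcoalgebra `D` of the transmuted braided
group `(H, Δ_R)`. -/
structure DComodStr (R : H ⊗[K] H) (D : Submodule K H) (W : Type*) [AddCommGroup W]
    [Module K W] where
  coact : W →ₗ[K] H ⊗[K] W
  mem : ∀ w : W, coact w ∈ Submodule.map₂ (TensorProduct.mk K H W) D ⊤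
  counit_coact : ∀ w : W,
    (TensorProduct.lid K W)
      ((LinearMap.rTensor W (Coalgebra.counit (R := K))) (coact w)) = w
  coassocR : (LinearMap.rTensor W (deltaR K H R)) ∘ₗ coact
      = (TensorProduct.assoc K H H W).symm.toLinearMap ∘ₗ
        (LinearMap.lTensor H coact) ∘ₗ coact

/-- The coaction `ρ_R(h ⊗ w) = Σ h₍₁₎ ·_ad w₍₋₁₎ ⊗ (h₍₂₎ ⊗ w₍₀₎)` on `H ⊗ W`. -/
noncomputable def rhoHW (R : H ⊗[K] H) {D : Submodule K H} {W : Type*} [AddCommGroup W]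
    [Module K W] (sW : DComodStr K H R D W) :
    H ⊗[K] W →ₗ[K] H ⊗[K] (H ⊗[K] W) :=
  (TensorProduct.map (adMap K H) LinearMap.id) ∘ₗ
    (TensorProduct.tensorTensorTensorComm K H H H W).toLinearMap ∘ₗ
    (TensorProduct.map (Coalgebra.comul (R := K)) sW.coact)

/-- The cotensor product `X □ Y ⊆ X ⊗ Y` of a right `H`-comodule `(X, ρX)` and a left
`H`-comodule `(Y, ρY)`. -/
noncomputable def cotensor {X Y : Type*} [AddCommGroup X] [Module K X] [AddCommGroup Y]
    [Module K Y] (ρX : X →ₗ[K] X ⊗[K] H) (ρY : Y →ₗ[K] H ⊗[K] Y) :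
    Submodule K (X ⊗[K] Y) :=
  LinearMap.ker ((TensorProduct.assoc K X H Y).toLinearMap ∘ₗ
    (LinearMap.rTensor Y ρX) - (LinearMap.lTensor X ρY))

/-- `ρ*` is the right comodule structure on `W*` dual to the left comodule structure
`coactW` on `W`:  `Σ ⟨f⁽⁰⁾, w⟩ f⁽¹⁾ = Σ w₍₋₁₎ ⟨f, w₍₀₎⟩`. -/
def IsDualCoaction {W : Type*} [AddCommGroup W] [Module K W]
    (coactW : W →ₗ[K] H ⊗[K] W)
    (ρstar : Module.Dual K W →ₗ[K] (Module.Dual K W) ⊗[K] H) : Prop :=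
  ∀ (f : Module.Dual K W) (w : W),
    (TensorProduct.lid K H) ((LinearMap.rTensor H ((Module.Dual.eval K W) w)) (ρstar f))
      = (TensorProduct.rid K H) ((LinearMap.lTensor H f) (coactW w))

/-- The space `Hom_H^D(V₁, V₂)` of maps which are simultaneously left `H`-module and
left comodule morphisms. -/
def homHD (R : H ⊗[K] H) {V₁ V₂ : Type*} [AddCommGroup V₁] [Module K V₁]
    [AddCommGroup V₂] [Module K V₂] (s : RModStr K H R V₁) (t : RModStr K H R V₂) :
    Submodule K (V₁ →ₗ[K] V₂) where
  carrier := {f | (∀ h : H, (t.act h : V₂ →ₗ[K] V₂) ∘ₗ f = f ∘ₗ (s.act h : V₁ →ₗ[K] V₁)) ∧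
    (LinearMap.lTensor H f) ∘ₗ s.coact = t.coact ∘ₗ f}
  add_mem' := by
    rintro f g ⟨hf1, hf2⟩ ⟨hg1, hg2⟩
    refine ⟨fun h => ?_, ?_⟩
    · rw [LinearMap.comp_add, LinearMap.add_comp, hf1 h, hg1 h]
    · rw [LinearMap.lTensor_add, LinearMap.add_comp, LinearMap.comp_add, hf2, hg2]
  zero_mem' := by
    refine ⟨fun h => ?_, ?_⟩ <;> simp
  smul_mem' := by
    rintro c f ⟨hf1, hf2⟩
    refine ⟨fun h => ?_, ?_⟩
    · rw [LinearMap.comp_smul, LinearMap.smul_comp, hf1 h]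
    · rw [LinearMap.lTensor_smul, LinearMap.smul_comp, LinearMap.comp_smul, hf2]

/-- The algebra `Hom_H^D(V, V)` of endomorphisms of `V` which are simultaneously left
`H`-module and left comodule morphisms. -/
def endHD (R : H ⊗[K] H) {V : Type*} [AddCommGroup V] [Module K V]
    (s : RModStr K H R V) : Subalgebra K (Module.End K V) where
  carrier := {f | (∀ h : H, (s.act h : V →ₗ[K] V) ∘ₗ f = f ∘ₗ (s.act h : V →ₗ[K] V)) ∧
    (LinearMap.lTensor H f) ∘ₗ s.coact = s.coact ∘ₗ f}
  add_mem' := by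
    rintro f g ⟨hf1, hf2⟩ ⟨hg1, hg2⟩
    refine ⟨fun h => ?_, ?_⟩
    · rw [LinearMap.comp_add, LinearMap.add_comp, hf1 h, hg1 h]
    · rw [LinearMap.lTensor_add, LinearMap.add_comp, LinearMap.comp_add, hf2, hg2]
  mul_mem' := by
    rintro f g ⟨hf1, hf2⟩ ⟨hg1, hg2⟩
    refine ⟨fun h => ?_, ?_⟩
    · show (s.act h : V →ₗ[K] V) ∘ₗ (f ∘ₗ g) = (f ∘ₗ g) ∘ₗ (s.act h : V →ₗ[K] V)
      rw [← LinearMap.comp_assoc, hf1 h, LinearMap.comp_assoc, hg1 h, LinearMap.comp_assoc]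
    · show (LinearMap.lTensor H (f ∘ₗ g)) ∘ₗ s.coact = s.coact ∘ₗ (f ∘ₗ g)
      rw [LinearMap.lTensor_comp, LinearMap.comp_assoc, hg2, ← LinearMap.comp_assoc, hf2,
        LinearMap.comp_assoc]
  algebraMap_mem' := by
    intro c
    refine ⟨fun h => ?_, ?_⟩
    · ext v
      simp [Module.algebraMap_end_apply]
    · ext v
      have : ((algebraMap K (Module.End K V)) c) = c • (LinearMap.id (M := V)) := by
        ext w; simp [Module.algebraMap_end_apply]
      simp [this, Module.algebraMap_end_apply]

section HomDimension

variable {K A V : Type} [Field K] [Ring A] [Algebra K A]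
  [AddCommGroup V] [Module K V] [Module A V] [IsScalarTower K A V]

lemma finiteDimensional_submodule_of_algebra {W : Type} [AddCommGroup W] [Module K W]
    [Module A W] [IsScalarTower K A W] [FiniteDimensional K W] (p : Submodule A W) :
    FiniteDimensional K p :=
  inferInstanceAs (FiniteDimensional K (p.restrictScalars K))

lemma finrank_linearMap_congr {W W' : Type} [AddCommGroup W]
    [Module A W] [AddCommGroup W']
    [Module A W'] (e : W ≃ₗ[A] W') :
    Module.finrank K (W →ₗ[A] V) = Module.finrank K (W' →ₗ[A] V) :=
  LinearEquiv.finrank_eq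
    { toFun := fun f => f ∘ₗ e.symm.toLinearMap
      invFun := fun f => f ∘ₗ e.toLinearMap
      map_add' := fun _ _ => rfl
      map_smul' := fun _ _ => rfl
      left_inv := fun f => by ext; simp
      right_inv := fun f => by ext; simp }

lemma finrank_linearMap_self : Module.finrank K (A →ₗ[A] V) = Module.finrank K V :=
  (LinearMap.ringLmapEquivSelf A K V).finrank_eq

variable [FiniteDimensional K V]

instance finiteDimensional_linearMap_of_algebra (W : Type) [AddCommGroup W] [Module K W]
    [Module A W] [IsScalarTower K A W] [FiniteDimensional K W] :
    FiniteDimensional K (W →ₗ[A] V) :=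
  Module.Finite.of_injective (LinearMap.restrictScalarsₗ K A W V K)
    (LinearMap.restrictScalars_injective K)

/-- Left exactness of `Hom(-, V)` bounds the dimension of `Hom(W, V)`. -/
lemma finrank_linearMap_le_add (W : Type) [AddCommGroup W] [Module K W]
    [Module A W] [IsScalarTower K A W] [FiniteDimensional K W] (p : Submodule A W) :
    Module.finrank K (W →ₗ[A] V) ≤
      Module.finrank K (p →ₗ[A] V) + Module.finrank K ((W ⧸ p) →ₗ[A] V) := by
  have := finiteDimensional_submodule_of_algebra (K := K) p
  let res : (W →ₗ[A] V) →ₗ[K] (p →ₗ[A] V) :=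
    { toFun := fun f => f ∘ₗ p.subtype
      map_add' := fun _ _ => rfl
      map_smul' := fun _ _ => rfl }
  let q : ((W ⧸ p) →ₗ[A] V) →ₗ[K] (W →ₗ[A] V) :=
    { toFun := fun f => f ∘ₗ p.mkQ
      map_add' := fun _ _ => rfl
      map_smul' := fun _ _ => rfl }
  have hle : LinearMap.ker res ≤ LinearMap.range q := by
    intro f hf
    have hf' : p ≤ LinearMap.ker f := fun w hw => by
      simpa [res] using LinearMap.congr_fun (LinearMap.mem_ker.1 hf) ⟨w, hw⟩
    exact ⟨p.liftQ f hf', by ext w; simp [q]⟩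
  have h1 := LinearMap.finrank_range_add_finrank_ker res
  have h2 := Submodule.finrank_le (LinearMap.range res)
  have h3 := Submodule.finrank_mono hle
  have h4 := LinearMap.finrank_range_le q
  omega

lemma finrank_linearMap_pi (ι W : Type) [Fintype ι] [AddCommGroup W] [Module K W]
    [Module A W] [IsScalarTower K A W] [FiniteDimensional K W] :
    Module.finrank K ((ι → W) →ₗ[A] V) = Fintype.card ι * Module.finrank K (W →ₗ[A] V) := by
  classical
  rw [← (LinearMap.lsum A (fun _ : ι => W) K (M := V)).finrank_eq, Module.finrank_pi_fintype]
  simp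

/-- A bound on the ratio `dim Hom(W, V) / dim W` for cyclic modules `W` holds for all modules. -/
lemma finrank_linearMap_mul_le (f₀ d₀ : ℕ)
    (hcyc : ∀ L : Submodule A A, L ≠ ⊤ →
      Module.finrank K ((A ⧸ L) →ₗ[A] V) * d₀ ≤ f₀ * Module.finrank K (A ⧸ L))
    (W : Type) [AddCommGroup W] [Module K W]
    [Module A W] [IsScalarTower K A W] [FiniteDimensional K W] :
    Module.finrank K (W →ₗ[A] V) * d₀ ≤ f₀ * Module.finrank K W := by
  induction hn : Module.finrank K W using Nat.strong_induction_on generalizing W with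
  | _ n ih =>
    by_cases hW : Subsingleton W
    · have : Subsingleton (W →ₗ[A] V) := ⟨fun f g => by ext w; simp [Subsingleton.elim w 0]⟩
      simp [Module.finrank_zero_of_subsingleton]
    obtain ⟨w, hw⟩ := @exists_ne W (not_subsingleton_iff_nontrivial.1 hW) 0
    let φ := LinearMap.toSpanSingleton A W w
    let p := LinearMap.range φ
    have := finiteDimensional_submodule_of_algebra (K := K) p
    have e : (A ⧸ LinearMap.ker φ) ≃ₗ[A] p := φ.quotKerEquivRange
    have hker : LinearMap.ker φ ≠ ⊤ := by
      intro h
      have : (1 : A) ∈ LinearMap.ker φ := h ▸ Submodule.mem_top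
      exact hw (by simpa [φ] using this)
    have h1 := hcyc _ hker
    rw [finrank_linearMap_congr e, (e.restrictScalars K).finrank_eq] at h1
    have hsum : Module.finrank K (W ⧸ p) + Module.finrank K p = Module.finrank K W :=
      Submodule.finrank_quotient_add_finrank (p.restrictScalars K)
    have hp : 0 < Module.finrank K p := by
      have : Nontrivial p := ⟨⟨⟨w, 1, by simp [φ]⟩, 0, by simpa [Subtype.ext_iff] using hw⟩⟩
      exact Module.finrank_pos
    have h2 := ih _ (by omega) (W ⧸ p) rfl
    have h3 := finrank_linearMap_le_add (K := K) (V := V) W p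
    nlinarith

/-- If every nonzero module `W` can be dominated by a faithful module `X` whose dimension is a
multiple of that of `W` and whose space of maps to `V` is at least as large in proportion, then
`dim Hom(W, V) / dim W` is the constant `dim V / dim A`. -/
theorem finrank_linearMap_mul_finrank_of_faithful [FiniteDimensional K A] [Nontrivial A]
    (d : ℕ)
    (H : ∀ (W : Type) [AddCommGroup W] [Module K W] [Module A W] [IsScalarTower K A W]
      [FiniteDimensional K W] [Nontrivial W],
      ∃ (X : Type) (_ : AddCommGroup X) (_ : Module K X) (_ : Module A X)
        (_ : IsScalarTower K A X) (_ : FiniteDimensional K X),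
        (∀ a : A, (∀ x : X, a • x = 0) → a = 0) ∧
        Module.finrank K X = d * Module.finrank K W ∧
        d * Module.finrank K (W →ₗ[A] V) ≤ Module.finrank K (X →ₗ[A] V))
    (W : Type) [AddCommGroup W] [Module K W] [Module A W] [IsScalarTower K A W]
    [FiniteDimensional K W] :
    Module.finrank K (W →ₗ[A] V) * Module.finrank K A =
      Module.finrank K V * Module.finrank K W := by
  let f : Submodule A A → ℕ := fun L => Module.finrank K ((A ⧸ L) →ₗ[A] V)
  let g : Submodule A A → ℕ := fun L => Module.finrank K (A ⧸ L)
  have hgpos : ∀ L : Submodule A A, L ≠ ⊤ → 0 < g L := fun L hL => by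
    have := Submodule.Quotient.nontrivial_iff.2 hL
    exact Module.finrank_pos
  have hgle : ∀ L, g L ≤ Module.finrank K A := fun L =>
    LinearMap.finrank_le_finrank_of_surjective (f := (L.mkQ).restrictScalars K)
      (Submodule.mkQ_surjective L)
  have hfle : ∀ L, f L ≤ Module.finrank K V := fun L => by
    rw [← finrank_linearMap_self (A := A)]
    refine LinearMap.finrank_le_finrank_of_injective
      (f := ({ toFun := fun f => f ∘ₗ L.mkQ
               map_add' := fun _ _ => rfl
               map_smul' := fun _ _ => rfl } : ((A ⧸ L) →ₗ[A] V) →ₗ[K] (A →ₗ[A] V))) ?_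
    intro x y hxy
    exact Submodule.linearMap_qext _ hxy
  let S : Set (ℕ × ℕ) := {x | ∃ L : Submodule A A, L ≠ ⊤ ∧ x = (f L, g L)}
  have hSfin : S.Finite := by
    refine (Set.finite_Iic (Module.finrank K V, Module.finrank K A)).subset ?_
    rintro _ ⟨L, -, rfl⟩
    exact ⟨hfle L, hgle L⟩
  have hSne : S.Nonempty := ⟨_, ⊥, bot_ne_top, rfl⟩
  obtain ⟨_, ⟨L₀, hL₀, rfl⟩, hmax⟩ :=
    Set.exists_max_image S (fun x => (x.1 : ℚ) / x.2) hSfin hSne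
  have hd₀ := hgpos L₀ hL₀
  have hle := finrank_linearMap_mul_le (K := K) (A := A) (V := V) (f L₀) (g L₀) (fun L hL => by
    have h := hmax _ ⟨L, hL, rfl⟩
    have h1 := hgpos L hL
    simp only at h
    rw [div_le_div_iff₀ (by exact_mod_cast h1) (by exact_mod_cast hd₀)] at h
    exact_mod_cast h)
  have : Nontrivial (A ⧸ L₀) := Submodule.Quotient.nontrivial_iff.2 hL₀
  obtain ⟨X, _, _, _, _, _, hfaith, hXdim, hXhom⟩ := H (A ⧸ L₀)
  -- an extremal module forces its submodules and quotients to be extremal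
  have key : ∀ (Y : Type) [AddCommGroup Y] [Module K Y] [Module A Y] [IsScalarTower K A Y]
      [FiniteDimensional K Y] (p : Submodule A Y),
      f L₀ * Module.finrank K Y ≤ Module.finrank K (Y →ₗ[A] V) * g L₀ →
      Module.finrank K (p →ₗ[A] V) * g L₀ = f L₀ * Module.finrank K p ∧
      Module.finrank K ((Y ⧸ p) →ₗ[A] V) * g L₀ = f L₀ * Module.finrank K (Y ⧸ p) := by
    intro Y _ _ _ _ _ p hY
    have := finiteDimensional_submodule_of_algebra (K := K) p
    have h1 := hle p
    have h2 := hle (Y ⧸ p)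
    have h3 := finrank_linearMap_le_add (K := K) (V := V) Y p
    have hsum : Module.finrank K (Y ⧸ p) + Module.finrank K p = Module.finrank K Y :=
      Submodule.finrank_quotient_add_finrank (p.restrictScalars K)
    have h4 := Nat.mul_le_mul_right (g L₀) h3
    rw [← hsum, mul_add] at hY
    rw [add_mul] at h4
    constructor <;> omega
  have hA : Module.finrank K V * g L₀ = f L₀ * Module.finrank K A := by
    let b := Module.finBasis K X
    let φ : A →ₗ[A] (Fin (Module.finrank K X) → X) :=
      LinearMap.pi fun i => LinearMap.toSpanSingleton A X (b i)
    have hφ : Function.Injective φ := by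
      rw [injective_iff_map_eq_zero]
      intro a ha
      refine hfaith a fun x => ?_
      have hz : Algebra.lsmul K K X a = 0 := b.ext fun i => by
        simpa [φ] using congrFun ha i
      exact LinearMap.congr_fun hz x
    let e := LinearEquiv.ofInjective φ hφ
    have h := (key _ (LinearMap.range φ) (by
      rw [finrank_linearMap_pi, Module.finrank_pi_fintype, Finset.sum_const, Fintype.card_fin,
        Finset.card_univ, Fintype.card_fin, smul_eq_mul]
      calc f L₀ * (Module.finrank K X * Module.finrank K X)
          = Module.finrank K X * (d * f L₀) * g L₀ := by
            conv_lhs => rw [hXdim]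
            rw [hXdim]; ring
        _ ≤ _ := Nat.mul_le_mul_right _ (Nat.mul_le_mul_left _ hXhom))).1
    rwa [← finrank_linearMap_congr e, finrank_linearMap_self,
      ← (e.restrictScalars K).finrank_eq] at h
  have hW : Module.finrank K (W →ₗ[A] V) * g L₀ = f L₀ * Module.finrank K W := by
    let b := Module.finBasis K W
    let φ : (Fin (Module.finrank K W) → A) →ₗ[A] W := Fintype.linearCombination A b
    have hφ : Function.Surjective φ := by
      intro w
      refine ⟨fun i => algebraMap K A (b.repr w i), ?_⟩
      simp only [φ, Fintype.linearCombination_apply, algebraMap_smul]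
      exact b.sum_repr w
    let e := φ.quotKerEquivOfSurjective hφ
    have h := (key _ (LinearMap.ker φ) (by
      rw [finrank_linearMap_pi, Module.finrank_pi_fintype, Finset.sum_const, Fintype.card_fin,
        Finset.card_univ, Fintype.card_fin, smul_eq_mul, finrank_linearMap_self, mul_assoc, hA]
      exact le_of_eq (by ring))).2
    rwa [finrank_linearMap_congr e, (e.restrictScalars K).finrank_eq] at h
  refine Nat.eq_of_mul_eq_mul_right hd₀ ?_
  calc _ = (Module.finrank K (W →ₗ[A] V) * g L₀) * Module.finrank K A := by ring
    _ = (f L₀ * Module.finrank K A) * Module.finrank K W := by rw [hW]; ring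
    _ = _ := by rw [← hA]; ring

end HomDimension

section Twist

open TensorProduct Coalgebra

/-- Coassociativity for a trilinear expression in Sweedler components. -/
lemma sum_coassoc_of_trilinear {K H M : Type} [Field K] [AddCommGroup H] [Module K H]
    [Coalgebra K H] [AddCommGroup M] [Module K M] (F : H → H → H → M)
    (h₁ : ∀ y z, IsLinearMap K fun x => F x y z) (h₂ : ∀ x z, IsLinearMap K fun y => F x y z)
    (h₃ : ∀ x y, IsLinearMap K fun z => F x y z) (h : H) {ι : Type} (r : Repr K h ι)
    {κ ν : Type} (s : ∀ i, Repr K (r.left i) κ) (t : ∀ i, Repr K (r.right i) ν) :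
    ∑ i ∈ r.index, ∑ j ∈ (s i).index, F ((s i).left j) ((s i).right j) (r.right i) =
      ∑ i ∈ r.index, ∑ j ∈ (t i).index, F (r.left i) ((t i).left j) ((t i).right j) := by
  let G : H →ₗ[K] H →ₗ[K] H →ₗ[K] M := LinearMap.mk₂ K (fun x y => (h₃ x y).mk')
    (fun a b c => by ext z; exact (h₁ c z).map_add a b)
    (fun k a c => by ext z; exact (h₁ c z).map_smul k a)
    (fun a b c => by ext z; exact (h₂ a z).map_add b c)
    (fun k a c => by ext z; exact (h₂ a z).map_smul k c)
  have key := congrArg (TensorProduct.lift (TensorProduct.lift.equiv (.id K) H H (H →ₗ[K] M) G))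
    (congrArg (TensorProduct.assoc K H H H).symm (sum_tmul_tmul_eq r s t))
  simpa [G, map_sum] using key

variable {K H A W : Type} [Field K] [Ring H] [HopfAlgebra K H] [Ring A] [Algebra K A]
  [AddCommGroup W] [Module K W] [Module A W] [IsScalarTower K A W]

/-- An algebra `A` with a right action `β` of `H` such that
`β_h(ab) = Σ β_{h₍₂₎}(a) β_{h₍₁₎}(b)`: the opposite of a right `H`-module algebra. -/
structure IsOpModuleAlgebra (β : H →ₗ[K] A →ₗ[K] A) : Prop where
  map_mul : ∀ (h : H) (a b : A), β h (a * b) =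
    ∑ i ∈ (ℛ K h).index, β ((ℛ K h).right i) a * β ((ℛ K h).left i) b
  map_one : ∀ h : H, β h 1 = counit (R := K) h • (1 : A)
  mul_apply : ∀ (g h : H) (a : A), β (g * h) a = β h (β g a)

/-- The operator `h ⊗ w ↦ Σ h₍₂₎ ⊗ β_{h₍₁₎}(a) w` on `H ⊗ W`. -/
noncomputable def twistEnd (β : H →ₗ[K] A →ₗ[K] A) (W : Type) [AddCommGroup W] [Module K W]
    [Module A W] [IsScalarTower K A W] (a : A) : Module.End K (H ⊗[K] W) :=
  (LinearMap.lTensor H (TensorProduct.lift ((Algebra.lsmul K K W).toLinearMap ∘ₗ β.flip a))) ∘ₗ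
    (TensorProduct.assoc K H H W).toLinearMap ∘ₗ
    (LinearMap.rTensor W ((TensorProduct.comm K H H).toLinearMap ∘ₗ comul))

lemma twistEnd_tmul (β : H →ₗ[K] A →ₗ[K] A) (a : A) (h : H) (w : W) {ι : Type}
    (r : Repr K h ι) :
    twistEnd β W a (h ⊗ₜ w) = ∑ i ∈ r.index, r.right i ⊗ₜ[K] (β (r.left i) a • w) := by
  simp [twistEnd, ← r.eq, map_sum, sum_tmul]

/-- The action of `A` on `H ⊗ W` by `a (h ⊗ w) = Σ h₍₂₎ ⊗ β_{h₍₁₎}(a) w`. -/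
noncomputable def twistHom {β : H →ₗ[K] A →ₗ[K] A} (hβ : IsOpModuleAlgebra β) (W : Type)
    [AddCommGroup W] [Module K W] [Module A W] [IsScalarTower K A W] :
    A →ₐ[K] Module.End K (H ⊗[K] W) :=
  AlgHom.ofLinearMap
    { toFun := twistEnd β W
      map_add' := fun a b => by
        ext h w
        simp [twistEnd_tmul β _ h w (ℛ K h), add_smul, tmul_add, Finset.sum_add_distrib]
      map_smul' := fun c a => by
        ext h w
        simp [twistEnd_tmul β _ h w (ℛ K h), Finset.smul_sum] }
    (by
      ext h w
      simp only [LinearMap.coe_mk, AddHom.coe_mk, AlgebraTensorModule.curry_apply,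
        LinearMap.restrictScalars_self, curry_apply, twistEnd_tmul β _ h w (ℛ K h), hβ.map_one,
        Module.End.one_apply, smul_assoc, one_smul, tmul_smul]
      simp only [smul_tmul', ← sum_tmul, sum_counit_smul])
    (fun a b => by
      ext h w
      simp only [LinearMap.coe_mk, AddHom.coe_mk, AlgebraTensorModule.curry_apply,
        LinearMap.restrictScalars_self, curry_apply, Module.End.mul_apply,
        twistEnd_tmul β _ h w (ℛ K h), map_sum, hβ.map_mul, Finset.sum_smul, mul_smul, tmul_sum]
      simp only [twistEnd_tmul β _ ((ℛ K h).right _) _ (ℛ K _)]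
      exact sum_coassoc_of_trilinear
        (fun x y z => z ⊗ₜ[K] (β y a • β x b • w))
        (fun y z => ⟨by simp [add_smul, tmul_add],
          fun c x => by simp [smul_comm (β y a) c]⟩)
        (fun y z => ⟨by simp [add_smul, tmul_add], by simp⟩)
        (fun y z => ⟨by simp [add_tmul], by simp [smul_tmul']⟩) h (ℛ K h)
        (fun _ => ℛ K _) (fun _ => ℛ K _))

/-- `H ⊗ W` as an `A`-module through `twistHom`. -/
noncomputable abbrev twistModule {β : H →ₗ[K] A →ₗ[K] A} (hβ : IsOpModuleAlgebra β) (W : Type)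
    [AddCommGroup W] [Module K W] [Module A W] [IsScalarTower K A W] : Module A (H ⊗[K] W) :=
  Module.compHom _ (twistHom hβ W).toRingHom

lemma twistModule_isScalarTower {β : H →ₗ[K] A →ₗ[K] A} (hβ : IsOpModuleAlgebra β) (W : Type)
    [AddCommGroup W] [Module K W] [Module A W] [IsScalarTower K A W] :
    letI := twistModule hβ W
    IsScalarTower K A (H ⊗[K] W) :=
  letI := twistModule hβ W
  ⟨fun c a x => LinearMap.congr_fun (map_smul (twistHom hβ W) c a) x⟩

/-- If `A` has no proper nonzero two-sided ideals stable under `H`, then `H ⊗ W` is faithful. -/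
lemma eq_zero_of_twistEnd_eq_zero [Nontrivial W] {β : H →ₗ[K] A →ₗ[K] A}
    (hβ : IsOpModuleAlgebra β)
    (hsimple : ∀ I : Submodule K A, (∀ a, ∀ b ∈ I, a * b ∈ I) → (∀ a, ∀ b ∈ I, b * a ∈ I) →
      (∀ h, ∀ a ∈ I, β h a ∈ I) → I = ⊥ ∨ I = ⊤)
    (a : A) (ha : twistEnd β W a = 0) : a = 0 := by
  let I : Submodule K A :=
    { carrier := {a | ∀ h : H, ∀ w : W, β h a • w = 0}
      add_mem' := fun {a b} ha hb h w => by simp [add_smul, ha h w, hb h w]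
      zero_mem' := fun h w => by simp
      smul_mem' := fun c a ha h w => by simp [ha h w] }
  have haI : a ∈ I := fun h w => by
    have h0 := congrArg ((TensorProduct.lid K W).toLinearMap ∘ₗ
      LinearMap.rTensor W (counit (R := K) (A := H)))
      (LinearMap.congr_fun ha (h ⊗ₜ w))
    rw [twistEnd_tmul β a h w (ℛ K h)] at h0
    simp only [map_sum, LinearMap.comp_apply, LinearMap.rTensor_tmul, LinearEquiv.coe_coe,
      lid_tmul, LinearMap.zero_apply, map_zero] at h0
    have h1 : ∑ i ∈ (ℛ K h).index, counit (R := K) ((ℛ K h).right i) • (ℛ K h).left i = h := by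
      have := congrArg (TensorProduct.rid K H) (sum_tmul_counit_eq (ℛ K h))
      simpa only [map_sum, rid_tmul, one_smul] using this
    rw [← h0]
    conv_lhs => rw [← h1]
    simp [map_sum, Finset.sum_smul]
  rcases hsimple I
    (fun a b hb h w => by
      rw [hβ.map_mul, Finset.sum_smul]
      exact Finset.sum_eq_zero fun i _ => by rw [mul_smul, hb, smul_zero])
    (fun a b hb h w => by
      rw [hβ.map_mul, Finset.sum_smul]
      exact Finset.sum_eq_zero fun i _ => by rw [mul_smul, hb])
    (fun h a ha g w => by rw [← hβ.mul_apply]; exact ha _ _) with hI | hI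
  · simpa [hI] using haI
  · obtain ⟨w, hw⟩ := exists_ne (0 : W)
    have h1 : (1 : A) ∈ I := hI ▸ Submodule.mem_top
    exact absurd (by simpa [hβ.map_one] using h1 1 w) hw

variable {V : Type} [AddCommGroup V] [Module K V] [Module A V] [IsScalarTower K A V]

/-- The map `h ⊗ w ↦ Σ h₍₁₎ θ(h₍₂₎)(w)`. -/
noncomputable def twistInduce (act : H →ₐ[K] Module.End K V) (θ : H →ₗ[K] (W →ₗ[A] V)) :
    H ⊗[K] W →ₗ[K] V :=
  TensorProduct.lift act.toLinearMap ∘ₗ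
    LinearMap.lTensor H (TensorProduct.lift (LinearMap.restrictScalarsₗ K A W V K ∘ₗ θ)) ∘ₗ
    (TensorProduct.assoc K H H W).toLinearMap ∘ₗ LinearMap.rTensor W comul

lemma twistInduce_tmul (act : H →ₐ[K] Module.End K V) (θ : H →ₗ[K] (W →ₗ[A] V)) (h : H) (w : W)
    {ι : Type} (r : Repr K h ι) :
    twistInduce act θ (h ⊗ₜ w) = ∑ i ∈ r.index, act (r.left i) (θ (r.right i) w) := by
  simp [twistInduce, ← r.eq, map_sum, sum_tmul]

lemma twistInduce_twistEnd {β : H →ₗ[K] A →ₗ[K] A} (act : H →ₐ[K] Module.End K V)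
    (hact : ∀ (h : H) (a : A) (v : V), a • act h v =
      ∑ i ∈ (ℛ K h).index, act ((ℛ K h).right i) (β ((ℛ K h).left i) a • v))
    (θ : H →ₗ[K] (W →ₗ[A] V)) (a : A) (x : H ⊗[K] W) :
    twistInduce act θ (twistEnd β W a x) = a • twistInduce act θ x := by
  induction x with
  | zero => simp
  | add x y hx hy => simp [hx, hy]
  | tmul h w =>
    rw [twistEnd_tmul β a h w (ℛ K h), twistInduce_tmul act θ h w (ℛ K h), map_sum,
      Finset.smul_sum]
    simp only [hact, twistInduce_tmul act θ ((ℛ K h).right _) _ (ℛ K _), ← map_smul]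
    exact (sum_coassoc_of_trilinear
      (fun x y z => act y (θ z (β x a • w)))
      (fun y z => ⟨by simp [add_smul], by simp⟩)
      (fun y z => ⟨by simp, by simp⟩)
      (fun x y => ⟨by simp, fun c z => by simp [smul_comm (β x a) c]⟩) h (ℛ K h)
      (fun _ => ℛ K _) (fun _ => ℛ K _)).symm

lemma twistInduce_injective (act : H →ₐ[K] Module.End K V) (θ : H →ₗ[K] (W →ₗ[A] V))
    (hθ : twistInduce act θ = 0) : θ = 0 := by
  ext h w
  have key := sum_coassoc_of_trilinear
      (fun x y z => act (HopfAlgebra.antipode K x * y) (θ z w))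
      (fun y z => ⟨by simp [add_mul], by simp⟩)
      (fun y z => ⟨by simp [mul_add], by simp⟩)
      (fun y z => ⟨by simp, by simp⟩) h (ℛ K h)
      (fun _ => ℛ K _) (fun _ => ℛ K _)
  have hz : ∀ g : H, ∑ i ∈ (ℛ K g).index, act ((ℛ K g).left i) (θ ((ℛ K g).right i) w) = 0 :=
    fun g => by rw [← twistInduce_tmul act θ g w (ℛ K g), hθ, LinearMap.zero_apply]
  simp only [map_mul, Module.End.mul_apply, ← map_sum, hz, map_zero, Finset.sum_const_zero] at key
  simp only [← Module.End.mul_apply, ← map_mul, ← LinearMap.sum_apply, ← map_sum,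
    HopfAlgebra.sum_antipode_mul_eq_smul] at key
  simp only [map_smul, map_one, LinearMap.smul_apply, Module.End.one_apply] at key
  have h1 := sum_counit_smul (ℛ K h)
  conv_lhs => rw [← h1]
  simpa [map_sum] using key

/-- For an `H`-simple opposite module algebra `A` and an equivariant module `V`, the dimension of
`Hom_A(W, V)` depends only on the dimension of `W`. -/
theorem finrank_linearMap_mul_finrank_of_isOpModuleAlgebra [FiniteDimensional K H]
    [FiniteDimensional K A] [Nontrivial A] [FiniteDimensional K V]
    {β : H →ₗ[K] A →ₗ[K] A} (hβ : IsOpModuleAlgebra β)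
    (hsimple : ∀ I : Submodule K A, (∀ a, ∀ b ∈ I, a * b ∈ I) → (∀ a, ∀ b ∈ I, b * a ∈ I) →
      (∀ h, ∀ a ∈ I, β h a ∈ I) → I = ⊥ ∨ I = ⊤)
    (act : H →ₐ[K] Module.End K V)
    (hact : ∀ (h : H) (a : A) (v : V), a • act h v =
      ∑ i ∈ (ℛ K h).index, act ((ℛ K h).right i) (β ((ℛ K h).left i) a • v))
    [FiniteDimensional K W] :
    Module.finrank K (W →ₗ[A] V) * Module.finrank K A =
      Module.finrank K V * Module.finrank K W := by
  refine finrank_linearMap_mul_finrank_of_faithful (Module.finrank K H) ?_ W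
  intro U _ _ _ _ _ _
  let := twistModule hβ U
  have := twistModule_isScalarTower hβ U
  refine ⟨H ⊗[K] U, inferInstance, inferInstance, inferInstance, inferInstance, inferInstance,
    fun a ha => eq_zero_of_twistEnd_eq_zero (W := U) hβ hsimple a (LinearMap.ext ha),
    Module.finrank_tensorProduct, ?_⟩
  rw [← Module.finrank_linearMap (S := K)]
  let Ψ : (H →ₗ[K] (U →ₗ[A] V)) →ₗ[K] (H ⊗[K] U →ₗ[A] V) :=
    { toFun := fun θ =>
        { toFun := twistInduce act θ
          map_add' := map_add _
          map_smul' := twistInduce_twistEnd act hact θ }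
      map_add' := fun θ η => LinearMap.ext fun x => by
        induction x with
        | zero => simp
        | add x y hx hy => simp only [map_add, hx, hy]
        | tmul h w =>
          change twistInduce act (θ + η) _ = twistInduce act θ _ + twistInduce act η _
          simp [twistInduce_tmul act _ h w (ℛ K h), Finset.sum_add_distrib]
      map_smul' := fun c θ => LinearMap.ext fun x => by
        induction x with
        | zero => simp
        | add x y hx hy => simp only [map_add, hx, hy]
        | tmul h w =>
          change twistInduce act (c • θ) _ = c • twistInduce act θ _
          simp [twistInduce_tmul act _ h w (ℛ K h), Finset.smul_sum] }
  refine LinearMap.finrank_le_finrank_of_injective (f := Ψ) ?_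
  rw [injective_iff_map_eq_zero]
  intro θ hθ
  exact twistInduce_injective act θ (LinearMap.ext fun x => LinearMap.congr_fun hθ x)

end Twist

section HopfIdentities

open TensorProduct Coalgebra WithConv
open HopfAlgebra (antipode)

variable {K H : Type} [Field K] [Ring H] [HopfAlgebra K H]

/-- The antipode is an anti-homomorphism of coalgebras. -/
lemma comul_antipode_eq (h : H) :
    comul (antipode K h) =
      TensorProduct.map (antipode K) (antipode K) (TensorProduct.comm K H H (comul h)) := by
  let l : WithConv (H →ₗ[K] H ⊗[K] H) := toConv ((TensorProduct.mk K H H).flip 1)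
  let r : WithConv (H →ₗ[K] H ⊗[K] H) := toConv (TensorProduct.mk K H H 1)
  let l' : WithConv (H →ₗ[K] H ⊗[K] H) := toConv ((TensorProduct.mk K H H).flip 1 ∘ₗ antipode K)
  let r' : WithConv (H →ₗ[K] H ⊗[K] H) := toConv (TensorProduct.mk K H H 1 ∘ₗ antipode K)
  have hl : l' * l = 1 := by
    ext x
    rw [(ℛ K x).convMul_apply]
    simp [l, l', ← sum_tmul, HopfAlgebra.sum_antipode_mul_eq_smul,
      Algebra.TensorProduct.one_def, smul_tmul', Algebra.algebraMap_eq_smul_one]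
  have hr : r' * r = 1 := by
    ext x
    rw [(ℛ K x).convMul_apply]
    simp [r, r', ← tmul_sum, HopfAlgebra.sum_antipode_mul_eq_smul, smul_tmul',
      Algebra.TensorProduct.one_def, Algebra.algebraMap_eq_smul_one]
  have hlr : l * r = toConv comul := by
    ext x
    rw [(ℛ K x).convMul_apply]
    simp [l, r, (ℛ K x).eq]
  have hinv : (r' * l') * toConv (comul (R := K) (A := H)) = 1 := by
    rw [← hlr, mul_assoc, ← mul_assoc l', hl, one_mul, hr]
  have key := left_inv_eq_right_inv hinv LinearMap.comul_right_inv
  have := congrArg (fun f => f.ofConv h) key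
  simp only [(ℛ K h).convMul_apply] at this
  simp only [LinearMap.comp_apply] at this
  rw [← this, ← (ℛ K h).eq]
  simp [r', l', map_sum]

lemma adMap_tmul (h a : H) {ι : Type} (r : Repr K h ι) :
    adMap K H (h ⊗ₜ a) = ∑ i ∈ r.index, r.left i * a * antipode K (r.right i) := by
  simp [adMap, ← r.eq, map_sum, sum_tmul, mul_assoc]

variable (K H) in
/-- The operators `x ↦ g x S(q)` for `g ⊗ q ∈ H ⊗ H`. -/
noncomputable def sandwichHom : H ⊗[K] H →ₐ[K] Module.End K H :=
  Algebra.TensorProduct.lift (Algebra.lmul K H)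
    (AlgHom.ofLinearMap ((LinearMap.mul K H).flip ∘ₗ antipode K)
      (by ext; simp)
      (fun x y => by ext; simp [HopfAlgebra.antipode_mul_antidistrib, mul_assoc]))
    (fun x y => (commute_iff_eq _ _).mpr (by ext; simp [mul_assoc]))

@[simp] lemma sandwichHom_tmul (g q x : H) :
    sandwichHom K H (g ⊗ₜ q) x = g * x * antipode K q := by
  rw [sandwichHom, Algebra.TensorProduct.lift_tmul]
  simp [mul_assoc]

variable (K H) in
/-- The adjoint action as an algebra homomorphism. -/
noncomputable def adHom : H →ₐ[K] Module.End K H :=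
  (sandwichHom K H).comp (Bialgebra.comulAlgHom K H)

lemma adHom_apply (h a : H) : adHom K H h a = adMap K H (h ⊗ₜ a) := by
  rw [adMap_tmul h a (ℛ K h)]
  simp only [adHom, AlgHom.comp_apply, Bialgebra.comulAlgHom_apply]
  rw [← (ℛ K h).eq]
  simp [map_sum]

lemma counit_adHom (h a : H) :
    counit (R := K) (adHom K H h a) = counit (R := K) h * counit (R := K) a := by
  rw [adHom_apply, adMap_tmul h a (ℛ K h)]
  have := congrArg (counit (R := K)) (sum_counit_smul (ℛ K h))
  simp only [map_sum, map_smul, smul_eq_mul] at this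
  simp only [map_sum, Bialgebra.counit_mul, HopfAlgebra.counit_antipode, ← this, Finset.sum_mul]
  exact Finset.sum_congr rfl fun i _ => by ring

variable (K H) in
/-- The operators `x ⊗ y ↦ g x S(q) ⊗ p ·_ad y` for `g ⊗ (p ⊗ q) ∈ H ⊗ (H ⊗ H)`. -/
noncomputable def sandwichAdHom : H ⊗[K] (H ⊗[K] H) →ₐ[K] Module.End K (H ⊗[K] H) :=
  (Module.endTensorEndAlgHom (R := K) (A := K) (M := H) (N := H)).comp <|
    (Algebra.TensorProduct.map (sandwichHom K H) (adHom K H)).comp <|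
    ((Algebra.TensorProduct.assoc K K K H H H).symm.toAlgHom).comp <|
    Algebra.TensorProduct.map (.id K H) (Algebra.TensorProduct.comm K H H).toAlgHom

lemma sandwichAdHom_tmul (g p q x y : H) :
    sandwichAdHom K H (g ⊗ₜ (p ⊗ₜ q)) (x ⊗ₜ y) =
      (g * x * antipode K q) ⊗ₜ adHom K H p y := by
  simp [sandwichAdHom, Module.endTensorEndAlgHom]

lemma deltaR_eq (R : H ⊗[K] H) (a : H) :
    deltaR K H R a = sandwichAdHom K H (1 ⊗ₜ R) (comul a) := by
  simp only [deltaR, LinearMap.comp_apply]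
  generalize (comul a : H ⊗[K] H) = z
  induction z with
  | zero => simp
  | add x y hx hy => simp only [map_add, hx, hy]
  | tmul x y =>
    induction R with
    | zero => simp
    | add x y hx hy => simp only [map_add, tmul_add, LinearMap.add_apply, hx, hy]
    | tmul p q => simp [sandwichAdHom_tmul, adHom_apply]

lemma comul_adHom (h a : H) :
    comul (R := K) (adHom K H h a) =
      sandwichAdHom K H (LinearMap.lTensor H comul (comul h)) (comul a) := by
  have h1 : ∀ z : H ⊗[K] H,
      ∑ i ∈ (ℛ K h).index, comul (R := K) ((ℛ K h).left i) * z *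
        comul (antipode K ((ℛ K h).right i)) =
      sandwichAdHom K H (LinearMap.lTensor H comul (comul h)) z := by
    intro z
    induction z with
    | zero => simp
    | add x y hx hy => simp only [map_add, mul_add, add_mul, Finset.sum_add_distrib, hx, hy]
    | tmul x y =>
      let F (a b c : H) : H ⊗[K] H := a ⊗ₜ[K] b * x ⊗ₜ[K] y *
        TensorProduct.map (antipode K) (antipode K) (TensorProduct.comm K H H (comul c))
      have hF := sum_coassoc_of_trilinear F
        (fun b c => ⟨by simp [F, add_tmul, add_mul], by simp [F, ← smul_tmul']⟩)
        (fun a c => ⟨by simp [F, add_mul, tmul_add], by simp [F]⟩)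
        (fun a b => ⟨by simp [F, mul_add], by simp [F]⟩) h (ℛ K h)
        (fun _ => ℛ K _) (fun _ => ℛ K _)
      have hG (a b : H) := sum_coassoc_of_trilinear
        (fun c d e => (a * x * antipode K e) ⊗ₜ[K] (c * y * antipode K d))
        (fun b c => ⟨by simp [tmul_add, add_mul], by simp⟩)
        (fun a c => ⟨by simp [mul_add, tmul_add], by simp⟩)
        (fun a b => ⟨by simp [mul_add, add_tmul], by simp [← smul_tmul']⟩) b (ℛ K b)
        (fun _ => ℛ K _) (fun _ => ℛ K _)
      trans ∑ i ∈ (ℛ K h).index, ∑ j ∈ (ℛ K ((ℛ K h).left i)).index,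
        F ((ℛ K ((ℛ K h).left i)).left j) ((ℛ K ((ℛ K h).left i)).right j) ((ℛ K h).right i)
      · refine Finset.sum_congr rfl fun i _ => ?_
        rw [comul_antipode_eq]
        conv_lhs => rw [← (ℛ K ((ℛ K h).left i)).eq]
        simp only [F, Finset.sum_mul]
      · rw [hF]
        conv_rhs => rw [← (ℛ K h).eq]
        simp only [map_sum, LinearMap.lTensor_tmul, LinearMap.sum_apply]
        refine Finset.sum_congr rfl fun i _ => ?_
        conv_rhs => rw [← (ℛ K ((ℛ K h).right i)).eq]
        simp only [tmul_sum, map_sum, LinearMap.sum_apply, sandwichAdHom_tmul, adHom_apply,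
          adMap_tmul _ y (ℛ K ((ℛ K ((ℛ K h).right i)).left _))]
        rw [hG]
        refine Finset.sum_congr rfl fun j _ => ?_
        simp only [F]
        conv_lhs => rw [← (ℛ K ((ℛ K ((ℛ K h).right i)).right j)).eq]
        simp [map_sum, Finset.mul_sum]
  rw [← h1, adHom_apply, adMap_tmul h a (ℛ K h)]
  simp [map_sum]

lemma map_adHom_comul (h : H) (z : H ⊗[K] H) :
    ∑ i ∈ (ℛ K h).index, TensorProduct.map (adHom K H ((ℛ K h).left i))
      (adHom K H ((ℛ K h).right i)) z =
    sandwichAdHom K H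
      (LinearMap.lTensor H ((TensorProduct.comm K H H).toLinearMap ∘ₗ comul) (comul h)) z := by
  induction z with
  | zero => simp
  | add x y hx hy => simp only [map_add, Finset.sum_add_distrib, hx, hy]
  | tmul x y =>
    have hF := sum_coassoc_of_trilinear
      (fun a b c => (a * x * antipode K b) ⊗ₜ[K] adHom K H c y)
      (fun b c => ⟨by simp [add_mul, add_tmul], by simp [← smul_tmul']⟩)
      (fun a c => ⟨by simp [mul_add, add_tmul], by simp [← smul_tmul']⟩)
      (fun a b => ⟨by simp [tmul_add], by simp⟩) h (ℛ K h)
      (fun _ => ℛ K _) (fun _ => ℛ K _)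
    simp only [map_tmul, adHom_apply _ x, adMap_tmul _ x (ℛ K _), sum_tmul]
    rw [hF]
    conv_rhs => rw [← (ℛ K h).eq]
    simp only [map_sum, LinearMap.lTensor_tmul, LinearMap.sum_apply]
    refine Finset.sum_congr rfl fun i _ => ?_
    conv_rhs => rw [LinearMap.comp_apply, ← (ℛ K ((ℛ K h).right i)).eq]
    simp [tmul_sum, map_sum, sandwichAdHom_tmul]

theorem deltaR_adHom {R : H ⊗[K] H} (hR : IsQuasiTriangular K H R) (h a : H) :
    deltaR K H R (adHom K H h a) =
      ∑ i ∈ (ℛ K h).index, TensorProduct.map (adHom K H ((ℛ K h).left i))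
        (adHom K H ((ℛ K h).right i)) (deltaR K H R a) := by
  rw [deltaR_eq, comul_adHom, map_adHom_comul, deltaR_eq, ← Module.End.mul_apply,
    ← Module.End.mul_apply, ← map_mul, ← map_mul, ← (ℛ K h).eq]
  simp only [map_sum, LinearMap.lTensor_tmul, Finset.mul_sum, Finset.sum_mul,
    Algebra.TensorProduct.tmul_mul_tmul, one_mul, mul_one, hR.intertwine, LinearMap.comp_apply,
    LinearEquiv.coe_coe]

end HopfIdentities

section BraidedCoalgebra

open TensorProduct Coalgebra

variable {K H : Type} [Field K] [Ring H] [HopfAlgebra K H]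

variable (K H) in
/-- The elements of `H` at which `Δ_R` satisfies the axioms of a coalgebra with counit `ε`. -/
noncomputable def deltaRCoalgebraLocus (R : H ⊗[K] H) : Submodule K H :=
  LinearMap.eqLocus
      ((TensorProduct.assoc K H H H).toLinearMap ∘ₗ LinearMap.rTensor H (deltaR K H R) ∘ₗ
        deltaR K H R)
      (LinearMap.lTensor H (deltaR K H R) ∘ₗ deltaR K H R) ⊓
    (LinearMap.eqLocus ((TensorProduct.lid K H).toLinearMap ∘ₗ
        LinearMap.rTensor H (counit (R := K)) ∘ₗ deltaR K H R) LinearMap.id ⊓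
      LinearMap.eqLocus ((TensorProduct.rid K H).toLinearMap ∘ₗ
        LinearMap.lTensor H (counit (R := K)) ∘ₗ deltaR K H R) LinearMap.id)

lemma mem_deltaRCoalgebraLocus {R : H ⊗[K] H} {a : H} :
    a ∈ deltaRCoalgebraLocus K H R ↔
      TensorProduct.assoc K H H H (LinearMap.rTensor H (deltaR K H R) (deltaR K H R a)) =
        LinearMap.lTensor H (deltaR K H R) (deltaR K H R a) ∧
      TensorProduct.lid K H (LinearMap.rTensor H (counit (R := K)) (deltaR K H R a)) = a ∧
      TensorProduct.rid K H (LinearMap.lTensor H (counit (R := K)) (deltaR K H R a)) = a :=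
  Iff.rfl

lemma adHom_mem_deltaRCoalgebraLocus {R : H ⊗[K] H} (hR : IsQuasiTriangular K H R) {a : H}
    (ha : a ∈ deltaRCoalgebraLocus K H R) (h : H) :
    adHom K H h a ∈ deltaRCoalgebraLocus K H R := by
  rw [mem_deltaRCoalgebraLocus] at ha ⊢
  obtain ⟨hassoc, hl, hr⟩ := ha
  rw [deltaR_adHom hR]
  refine ⟨?_, ?_, ?_⟩
  · have h₁ : ∀ (x y : H) (z : H ⊗[K] H),
        TensorProduct.assoc K H H H (LinearMap.rTensor H (deltaR K H R)
          (TensorProduct.map (adHom K H x) (adHom K H y) z)) =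
        ∑ j ∈ (ℛ K x).index, TensorProduct.map (adHom K H ((ℛ K x).left j))
          (TensorProduct.map (adHom K H ((ℛ K x).right j)) (adHom K H y))
          (TensorProduct.assoc K H H H (LinearMap.rTensor H (deltaR K H R) z)) := by
      intro x y z
      induction z with
      | zero => simp
      | add u v hu hv => simp only [map_add, hu, hv, Finset.sum_add_distrib]
      | tmul u v =>
        simp only [map_tmul, LinearMap.rTensor_tmul, deltaR_adHom hR x u, sum_tmul, map_sum]
        refine Finset.sum_congr rfl fun j _ => ?_
        generalize deltaR K H R u = w
        induction w with
        | zero => simp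
        | add u v hu hv => simp only [map_add, add_tmul, hu, hv]
        | tmul p q => simp
    have h₂ : ∀ (x y : H) (z : H ⊗[K] H),
        LinearMap.lTensor H (deltaR K H R)
          (TensorProduct.map (adHom K H x) (adHom K H y) z) =
        ∑ j ∈ (ℛ K y).index, TensorProduct.map (adHom K H x)
          (TensorProduct.map (adHom K H ((ℛ K y).left j)) (adHom K H ((ℛ K y).right j)))
          (LinearMap.lTensor H (deltaR K H R) z) := by
      intro x y z
      induction z with
      | zero => simp
      | add u v hu hv => simp only [map_add, hu, hv, Finset.sum_add_distrib]
      | tmul u v => simp only [map_tmul, LinearMap.lTensor_tmul, deltaR_adHom hR y v, tmul_sum]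
    simp only [map_sum, h₁, h₂, hassoc]
    generalize LinearMap.lTensor H (deltaR K H R) (deltaR K H R a) = Y
    exact sum_coassoc_of_trilinear
      (fun x y z => TensorProduct.map (adHom K H x)
        (TensorProduct.map (adHom K H y) (adHom K H z)) Y)
      (fun b c => ⟨by simp [map_add_left], by simp [map_smul_left]⟩)
      (fun a c => ⟨by simp [map_add_left, map_add_right], by simp [map_smul_left, map_smul_right]⟩)
      (fun a b => ⟨by simp [map_add_right], by simp [map_smul_right]⟩) h (ℛ K h)
      (fun _ => ℛ K _) (fun _ => ℛ K _)
  · have h₁ : ∀ (x y : H) (z : H ⊗[K] H),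
        TensorProduct.lid K H (LinearMap.rTensor H (counit (R := K))
          (TensorProduct.map (adHom K H x) (adHom K H y) z)) =
        adHom K H (counit (R := K) x • y)
          (TensorProduct.lid K H (LinearMap.rTensor H (counit (R := K)) z)) := by
      intro x y z
      induction z with
      | zero => simp
      | add u v hu hv => simp only [map_add, hu, hv]
      | tmul u v =>
        simp only [map_tmul, LinearMap.rTensor_tmul, lid_tmul, counit_adHom, mul_smul, map_smul,
          LinearMap.smul_apply]
        rw [smul_comm]
    simp only [map_sum, h₁, hl]
    rw [← LinearMap.sum_apply, ← map_sum, sum_counit_smul]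
  · have h₁ : ∀ (x y : H) (z : H ⊗[K] H),
        TensorProduct.rid K H (LinearMap.lTensor H (counit (R := K))
          (TensorProduct.map (adHom K H x) (adHom K H y) z)) =
        adHom K H (counit (R := K) y • x)
          (TensorProduct.rid K H (LinearMap.lTensor H (counit (R := K)) z)) := by
      intro x y z
      induction z with
      | zero => simp
      | add u v hu hv => simp only [map_add, hu, hv]
      | tmul u v =>
        simp only [map_tmul, LinearMap.lTensor_tmul, rid_tmul, counit_adHom, mul_smul, map_smul,
          LinearMap.smul_apply]
        rw [smul_comm]
    simp only [map_sum, h₁, hr]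
    rw [← LinearMap.sum_apply, ← map_sum]
    have := congrArg (TensorProduct.rid K H) (sum_tmul_counit_eq (ℛ K h))
    simp only [map_sum, rid_tmul, one_smul] at this
    rw [this]

section Coefficients

variable {R : H ⊗[K] H} {D : Submodule K H} {W : Type} [AddCommGroup W] [Module K W]
  (sW : DComodStr K H R D W)

/-- The matrix coefficients `w ↦ Σ w₍₋₁₎ ξ(w₍₀₎)` of a comodule. -/
noncomputable def DComodStr.coeff (ξ : Module.Dual K W) : W →ₗ[K] H :=
  (TensorProduct.rid K H).toLinearMap ∘ₗ LinearMap.lTensor H ξ ∘ₗ sW.coact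

lemma DComodStr.deltaR_coeff (ξ : Module.Dual K W) (w : W) :
    deltaR K H R (sW.coeff ξ w) = LinearMap.lTensor H (sW.coeff ξ) (sW.coact w) := by
  have h1 := LinearMap.congr_fun sW.coassocR w
  simp only [LinearMap.comp_apply, LinearEquiv.coe_coe] at h1
  have h2 := congrArg (fun z => TensorProduct.rid K (H ⊗[K] H)
    (LinearMap.lTensor (H ⊗[K] H) ξ z)) h1
  convert h2 using 1
  · simp only [coeff, LinearMap.comp_apply, LinearEquiv.coe_coe]
    generalize sW.coact w = z
    induction z with
    | zero => simp
    | add u v hu hv => simp only [map_add, hu, hv]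
    | tmul u v => simp
  · simp only [coeff]
    generalize sW.coact w = z
    induction z with
    | zero => simp
    | add u v hu hv => simp only [map_add, hu, hv]
    | tmul u v =>
      simp only [LinearMap.lTensor_tmul, LinearMap.comp_apply, LinearEquiv.coe_coe]
      generalize sW.coact v = z
      induction z with
      | zero => simp
      | add u v hu hv => simp only [map_add, tmul_add, hu, hv]
      | tmul u v => simp

lemma DComodStr.counit_coeff (ξ : Module.Dual K W) (w : W) :
    counit (R := K) (sW.coeff ξ w) = ξ w := by
  conv_rhs => rw [← sW.counit_coact w]
  simp only [coeff, LinearMap.comp_apply, LinearEquiv.coe_coe]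
  generalize sW.coact w = z
  induction z with
  | zero => simp
  | add u v hu hv => simp only [map_add, hu, hv]
  | tmul u v => simp [mul_comm]

lemma DComodStr.coeff_mem_deltaRCoalgebraLocus (ξ : Module.Dual K W) (w : W) :
    sW.coeff ξ w ∈ deltaRCoalgebraLocus K H R := by
  rw [mem_deltaRCoalgebraLocus, sW.deltaR_coeff]
  have h1 := LinearMap.congr_fun sW.coassocR w
  simp only [LinearMap.comp_apply, LinearEquiv.coe_coe, LinearEquiv.eq_symm_apply] at h1
  refine ⟨?_, ?_, ?_⟩
  · have h₂ : ∀ z : H ⊗[K] W, TensorProduct.assoc K H H H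
        (LinearMap.rTensor H (deltaR K H R) (LinearMap.lTensor H (sW.coeff ξ) z)) =
        LinearMap.lTensor H (LinearMap.lTensor H (sW.coeff ξ))
          (TensorProduct.assoc K H H W (LinearMap.rTensor W (deltaR K H R) z)) := by
      intro z
      induction z with
      | zero => simp
      | add u v hu hv => simp only [map_add, hu, hv]
      | tmul u v =>
        simp only [LinearMap.lTensor_tmul, LinearMap.rTensor_tmul]
        generalize deltaR K H R u = y
        induction y with
        | zero => simp
        | add u v hu hv => simp only [map_add, add_tmul, hu, hv]
        | tmul p q => simp
    rw [h₂, h1]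
    generalize sW.coact w = z
    induction z with
    | zero => simp
    | add u v hu hv => simp only [map_add, hu, hv]
    | tmul u v => simp [sW.deltaR_coeff]
  · conv_rhs => rw [← sW.counit_coact w]
    generalize sW.coact w = z
    induction z with
    | zero => simp
    | add u v hu hv => simp only [map_add, hu, hv]
    | tmul u v => simp
  · conv_rhs => rw [coeff, LinearMap.comp_apply, LinearMap.comp_apply]
    generalize sW.coact w = z
    induction z with
    | zero => simp
    | add u v hu hv => simp only [map_add, hu, hv]
    | tmul u v => simp [sW.counit_coeff]

lemma sum_lTensor_coord_tmul {M ι : Type} [AddCommGroup M] [Module K M] [Fintype ι]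
    (b : Module.Basis ι K W) (z : M ⊗[K] W) :
    ∑ i, TensorProduct.rid K M (LinearMap.lTensor M (b.coord i) z) ⊗ₜ[K] b i = z := by
  induction z with
  | zero => simp
  | add u v hu hv => simp only [map_add, add_tmul, Finset.sum_add_distrib, hu, hv]
  | tmul u v =>
    simp only [LinearMap.lTensor_tmul, rid_tmul, Module.Basis.coord_apply, smul_tmul, ← tmul_sum,
      b.sum_repr]

lemma mem_map₂_of_forall_dual [FiniteDimensional K W] {M : Type} [AddCommGroup M] [Module K M]
    {C : Submodule K M} {z : M ⊗[K] W}
    (hz : ∀ ξ : Module.Dual K W, TensorProduct.rid K M (LinearMap.lTensor M ξ z) ∈ C) :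
    z ∈ Submodule.map₂ (TensorProduct.mk K M W) C ⊤ := by
  rw [← sum_lTensor_coord_tmul (Module.finBasis K W) z]
  exact Submodule.sum_mem _ fun i _ => Submodule.apply_mem_map₂ _ (hz _) Submodule.mem_top

lemma lTensor_mem_of_mem_map₂ {M : Type} [AddCommGroup M] [Module K M]
    {C : Submodule K M} {z : M ⊗[K] W} (hz : z ∈ Submodule.map₂ (TensorProduct.mk K M W) C ⊤)
    (ξ : Module.Dual K W) : TensorProduct.rid K M (LinearMap.lTensor M ξ z) ∈ C := by
  have : Submodule.map₂ (TensorProduct.mk K M W) C ⊤ ≤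
      C.comap ((TensorProduct.rid K M).toLinearMap ∘ₗ LinearMap.lTensor M ξ) :=
    Submodule.map₂_le.2 fun m hm w _ => by simpa using C.smul_mem _ hm
  exact this hz

/-- On a minimal adjoint-stable subcoalgebra which has a nonzero comodule, `Δ_R` is
coassociative and counital. -/
theorem DComodStr.le_deltaRCoalgebraLocus [FiniteDimensional K W] [Nontrivial W]
    (sW : DComodStr K H R D W)
    (hR : IsQuasiTriangular K H R) (hD : IsMinimalAdjointStableSubcoalgebra K H R D) :
    D ≤ deltaRCoalgebraLocus K H R := by
  let C : Submodule K H := Submodule.span K {c | ∃ ξ w, sW.coeff ξ w = c}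
  let D' : Submodule K H := Submodule.map₂ (adHom K H).toLinearMap ⊤ C
  have hCD' : C ≤ D' := fun c hc => by
    simpa using Submodule.apply_mem_map₂ (adHom K H).toLinearMap (Submodule.mem_top (x := 1)) hc
  have hCD : C ≤ D := Submodule.span_le.2 <| by
    rintro _ ⟨ξ, w, rfl⟩
    exact lTensor_mem_of_mem_map₂ (sW.mem w) ξ
  have hD'D : D' ≤ D := Submodule.map₂_le.2 fun h _ c hc => by
    simpa [adHom_apply, adAct] using hD.2.1.1 h c (hCD hc)
  have hD'E : D' ≤ deltaRCoalgebraLocus K H R := by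
    refine Submodule.map₂_le.2 fun h _ c hc => adHom_mem_deltaRCoalgebraLocus hR ?_ h
    refine Submodule.span_le.2 ?_ hc
    rintro _ ⟨ξ, w, rfl⟩
    exact sW.coeff_mem_deltaRCoalgebraLocus ξ w
  have hC : ∀ c ∈ C, deltaR K H R c ∈ Submodule.map₂ (TensorProduct.mk K H H) C C := by
    intro c hc
    refine (Submodule.span_le (p := (Submodule.map₂ (TensorProduct.mk K H H) C C).comap
      (deltaR K H R))).2 ?_ hc
    rintro _ ⟨ξ, w, rfl⟩
    rw [SetLike.mem_coe, Submodule.mem_comap, sW.deltaR_coeff]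
    have h1 : sW.coact w ∈ Submodule.map₂ (TensorProduct.mk K H W) C ⊤ :=
      mem_map₂_of_forall_dual fun η => Submodule.subset_span ⟨η, w, rfl⟩
    refine (Submodule.map₂_le (r := (Submodule.map₂ (TensorProduct.mk K H H) C C).comap
      (LinearMap.lTensor H (sW.coeff ξ)))).2 (fun c hc v _ => ?_) h1
    exact Submodule.apply_mem_map₂ (TensorProduct.mk K H H) hc (Submodule.subset_span ⟨ξ, v, rfl⟩)
  have hstable : IsAdjointStableSubcoalgebra K H R D' := by
    constructor
    · intro h a ha
      rw [adAct, ← adHom_apply]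
      refine (Submodule.map₂_le (r := D'.comap (adHom K H h))).2 (fun g _ c hc => ?_) ha
      simpa using Submodule.apply_mem_map₂ (adHom K H).toLinearMap
        (Submodule.mem_top (x := h * g)) hc
    · intro a ha
      refine (Submodule.map₂_le (r := (Submodule.map₂ (TensorProduct.mk K H H) D' D').comap
        (deltaR K H R))).2 (fun g _ c hc => ?_) ha
      rw [Submodule.mem_comap, AlgHom.toLinearMap_apply, deltaR_adHom hR]
      refine Submodule.sum_mem _ fun i _ => ?_
      refine (Submodule.map₂_le (r := (Submodule.map₂ (TensorProduct.mk K H H) D' D').comap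
        (TensorProduct.map _ _))).2 (fun x hx y hy => ?_) (hC c hc)
      exact Submodule.apply_mem_map₂ (TensorProduct.mk K H H)
        (Submodule.apply_mem_map₂ (adHom K H).toLinearMap Submodule.mem_top hx)
        (Submodule.apply_mem_map₂ (adHom K H).toLinearMap Submodule.mem_top hy)
  rcases hD.2.2 D' hD'D hstable with h0 | h0
  · obtain ⟨w, hw⟩ := exists_ne (0 : W)
    refine absurd ((Module.forall_dual_apply_eq_zero_iff K w).1 fun ξ => ?_) hw
    have : sW.coeff ξ w ∈ D' := hCD' (Submodule.subset_span ⟨ξ, w, rfl⟩)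
    rw [h0, Submodule.mem_bot] at this
    rw [← sW.counit_coeff, this, map_zero]
  · exact h0 ▸ hD'E

end Coefficients

end BraidedCoalgebra

section CoopComodule

open TensorProduct Coalgebra WithConv

variable {K H D U : Type} [Field K] [Ring H] [HopfAlgebra K H] [AddCommGroup D] [Module K D]
  [AddCommGroup U] [Module K U]

/-- The operator `u ↦ Σ ζ(u₍₋₁₎) u₍₀₎`. -/
noncomputable def contract {C : Type} [AddCommGroup C] [Module K C] (ρ : U →ₗ[K] C ⊗[K] U)
    (ζ : Module.Dual K C) : Module.End K U :=
  (TensorProduct.lid K U).toLinearMap ∘ₗ LinearMap.rTensor U ζ ∘ₗ ρ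

/-- The action `(β_h a)(d) = a(h d)` on the convolution algebra of `D`. -/
noncomputable def dualAction (ad : H →ₐ[K] Module.End K D) :
    H →ₗ[K] WithConv (D →ₗ[K] K) →ₗ[K] WithConv (D →ₗ[K] K) :=
  LinearMap.mk₂ K (fun h a => toConv (a.ofConv ∘ₗ ad h))
    (fun g h a => by ext; simp) (fun c h a => by ext; simp)
    (fun h a b => by ext; simp) (fun c h a => by ext; simp)

lemma dualAction_apply (ad : H →ₐ[K] Module.End K D) (h : H) (a : WithConv (D →ₗ[K] K)) :
    dualAction ad h a = toConv (a.ofConv ∘ₗ ad h) := rfl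

/-- A tensor lying in `P ⊗ D` and in `D ⊗ P` lies in `P ⊗ P`. -/
lemma mem_map₂_of_mem_map₂ {P : Submodule K D} {x : D ⊗[K] D}
    (h₁ : x ∈ Submodule.map₂ (TensorProduct.mk K D D) P ⊤)
    (h₂ : x ∈ Submodule.map₂ (TensorProduct.mk K D D) ⊤ P) :
    x ∈ Submodule.map₂ (TensorProduct.mk K D D) P P := by
  obtain ⟨q, hq⟩ := LinearMap.exists_leftInverse_of_injective P.subtype P.ker_subtype
  have hq' : ∀ d ∈ P, (q d : D) = d := fun d hd =>
    congrArg Subtype.val (LinearMap.congr_fun hq ⟨d, hd⟩)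
  have e₁ : LinearMap.rTensor D (P.subtype ∘ₗ q) x = x := by
    refine (Submodule.map₂_le (r := LinearMap.eqLocus (LinearMap.rTensor D (P.subtype ∘ₗ q))
      LinearMap.id)).2 (fun d hd e _ => ?_) h₁
    simp [hq' d hd]
  have e₂ : LinearMap.lTensor D (P.subtype ∘ₗ q) x = x := by
    refine (Submodule.map₂_le (r := LinearMap.eqLocus (LinearMap.lTensor D (P.subtype ∘ₗ q))
      LinearMap.id)).2 (fun d _ e he => ?_) h₂
    simp [hq' e he]
  rw [← e₁]
  refine (Submodule.map₂_le (r := (Submodule.map₂ (TensorProduct.mk K D D) P P).comap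
    (LinearMap.rTensor D (P.subtype ∘ₗ q)))).2 (fun d _ e he => ?_) h₂
  exact Submodule.apply_mem_map₂ (TensorProduct.mk K D D) (q d).2 he

lemma sum_tmul_rTensor_coord {ι : Type} [Fintype ι] (b : Module.Basis ι K D) (z : D ⊗[K] U) :
    ∑ i, b i ⊗ₜ[K] TensorProduct.lid K U (LinearMap.rTensor U (b.coord i) z) = z := by
  induction z with
  | zero => simp
  | add u v hu hv => simp only [map_add, tmul_add, Finset.sum_add_distrib, hu, hv]
  | tmul u v =>
    simp only [LinearMap.rTensor_tmul, lid_tmul, Module.Basis.coord_apply, ← smul_tmul, ← sum_tmul,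
      b.sum_repr]

lemma mem_map₂_top_of_forall_dual [FiniteDimensional K D] {P : Submodule K U} {z : D ⊗[K] U}
    (hz : ∀ ξ : Module.Dual K D, TensorProduct.lid K U (LinearMap.rTensor U ξ z) ∈ P) :
    z ∈ Submodule.map₂ (TensorProduct.mk K D U) ⊤ P := by
  rw [← sum_tmul_rTensor_coord (Module.finBasis K D) z]
  exact Submodule.sum_mem _ fun i _ => Submodule.apply_mem_map₂ _ Submodule.mem_top (hz _)

variable [Coalgebra K D]

/-- A left comodule `ρ : U → D ⊗ U` over the co-opposite of the coalgebra `D`. -/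
structure IsCoopCoaction (ρ : U →ₗ[K] D ⊗[K] U) : Prop where
  coassoc : ∀ u, TensorProduct.assoc K D D U (LinearMap.rTensor U comul (ρ u)) =
    TensorProduct.leftComm K D D U (LinearMap.lTensor D ρ (ρ u))
  counit : ∀ u, TensorProduct.lid K U (LinearMap.rTensor U (counit (R := K)) (ρ u)) = u

/-- A comodule over the co-opposite of `D` is a module over the convolution algebra of `D`. -/
noncomputable def IsCoopCoaction.hom {ρ : U →ₗ[K] D ⊗[K] U} (hρ : IsCoopCoaction ρ) :
    WithConv (D →ₗ[K] K) →ₐ[K] Module.End K U :=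
  AlgHom.ofLinearMap
    { toFun := fun a => contract ρ a.ofConv
      map_add' := fun a b => by simp [contract, LinearMap.rTensor_add, LinearMap.add_comp,
        LinearMap.comp_add]
      map_smul' := fun c a => by simp [contract, LinearMap.rTensor_smul, LinearMap.smul_comp,
        LinearMap.comp_smul] }
    (LinearMap.ext fun u => by
      have h1 : (1 : WithConv (D →ₗ[K] K)).ofConv = Coalgebra.counit := by
        ext; simp
      simpa [contract, h1] using hρ.counit u)
    (fun a b => LinearMap.ext fun u => by
      let E : D ⊗[K] (D ⊗[K] U) →ₗ[K] U := (TensorProduct.lid K U).toLinearMap ∘ₗ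
        LinearMap.rTensor U a.ofConv ∘ₗ LinearMap.lTensor D ((TensorProduct.lid K U).toLinearMap ∘ₗ
          LinearMap.rTensor U b.ofConv)
      have h1 : ∀ z : D ⊗[K] U, TensorProduct.lid K U (LinearMap.rTensor U (a * b).ofConv z) =
          E (TensorProduct.assoc K D D U (LinearMap.rTensor U comul z)) := by
        intro z
        induction z with
        | zero => simp
        | add x y hx hy => simp only [map_add, hx, hy]
        | tmul d u =>
          simp only [LinearMap.rTensor_tmul, LinearMap.convMul_def, LinearMap.comp_apply]
          generalize comul (R := K) d = y
          induction y with
          | zero => simp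
          | add x y hx hy => simp only [map_add, add_tmul, hx, hy]
          | tmul p q => simp [E, smul_smul, mul_comm]
      have h2 : ∀ z : D ⊗[K] U,
          E (TensorProduct.leftComm K D D U (LinearMap.lTensor D ρ z)) =
          contract ρ a.ofConv (TensorProduct.lid K U (LinearMap.rTensor U b.ofConv z)) := by
        intro z
        induction z with
        | zero => simp
        | add x y hx hy => simp only [map_add, hx, hy]
        | tmul d u =>
          simp only [LinearMap.rTensor_tmul, LinearMap.lTensor_tmul, lid_tmul, map_smul, contract,
            LinearMap.comp_apply]
          generalize ρ u = y
          induction y with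
          | zero => simp
          | add x y hx hy => simp only [map_add, tmul_add, smul_add, hx, hy]
          | tmul p q =>
            simp only [E, LinearMap.comp_apply, LinearMap.lTensor_tmul, LinearMap.rTensor_tmul,
              leftComm_tmul, LinearEquiv.coe_coe, lid_tmul]
            rw [smul_comm]
      change TensorProduct.lid K U (LinearMap.rTensor U (a * b).ofConv (ρ u)) = _
      rw [h1, hρ.coassoc, h2]
      rfl)

lemma isOpModuleAlgebra_dualAction {ad : H →ₐ[K] Module.End K D}
    (hcomul : ∀ h d, comul (R := K) (ad h d) = ∑ i ∈ (ℛ K h).index,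
      TensorProduct.map (ad ((ℛ K h).right i)) (ad ((ℛ K h).left i)) (comul d))
    (hcounit : ∀ h d, counit (R := K) (ad h d) = counit (R := K) h * counit (R := K) d) :
    IsOpModuleAlgebra (dualAction ad) where
  map_mul h a b := by
    ext d
    simp only [dualAction_apply, LinearMap.convMul_apply, LinearMap.comp_apply, hcomul, map_sum,
      WithConv.ofConv_sum, LinearMap.sum_apply, WithConv.ofConv_toConv]
    refine Finset.sum_congr rfl fun i _ => ?_
    generalize comul (R := K) d = y
    induction y with
    | zero => simp
    | add x y hx hy => simp only [map_add, hx, hy]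
    | tmul p q => simp
  map_one h := by
    ext d
    simp [dualAction_apply, hcounit]
  mul_apply g h a := by
    ext d
    simp [dualAction_apply]

lemma convMul_apply_eq_left (a b : WithConv (D →ₗ[K] K)) (d : D) :
    (a * b).ofConv d = a.ofConv (TensorProduct.rid K D (LinearMap.lTensor D b.ofConv (comul d))) := by
  rw [LinearMap.convMul_apply]
  generalize comul (R := K) d = y
  induction y with
  | zero => simp
  | add x y hx hy => simp only [map_add, hx, hy]
  | tmul p q => simp [mul_comm]

lemma convMul_apply_eq_right (a b : WithConv (D →ₗ[K] K)) (d : D) :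
    (a * b).ofConv d = b.ofConv (TensorProduct.lid K D (LinearMap.rTensor D a.ofConv (comul d))) := by
  rw [LinearMap.convMul_apply]
  generalize comul (R := K) d = y
  induction y with
  | zero => simp
  | add x y hx hy => simp only [map_add, hx, hy]
  | tmul p q => simp

lemma eq_bot_or_eq_top_of_dualAction_mem [FiniteDimensional K D] {ad : H →ₐ[K] Module.End K D}
    (hsimple : ∀ P : Submodule K D, (∀ h, ∀ d ∈ P, ad h d ∈ P) →
      (∀ d ∈ P, comul (R := K) d ∈ Submodule.map₂ (TensorProduct.mk K D D) P P) →
      P = ⊥ ∨ P = ⊤)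
    (I : Submodule K (WithConv (D →ₗ[K] K))) (hl : ∀ a, ∀ b ∈ I, a * b ∈ I)
    (hr : ∀ a, ∀ b ∈ I, b * a ∈ I) (hI : ∀ h, ∀ a ∈ I, dualAction ad h a ∈ I) :
    I = ⊥ ∨ I = ⊤ := by
  let e := WithConv.linearEquiv K (D →ₗ[K] K)
  let J : Submodule K (Module.Dual K D) := I.map e.toLinearMap
  let P := J.dualCoannihilator
  have hP : ∀ d, d ∈ P ↔ ∀ a ∈ I, a.ofConv d = 0 := by
    intro d
    rw [Submodule.mem_dualCoannihilator]
    exact ⟨fun h a ha => h _ (Submodule.mem_map_of_mem ha), fun h φ hφ => by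
      obtain ⟨a, ha, rfl⟩ := hφ
      exact h a ha⟩
  have hJ : P.dualAnnihilator = J := Subspace.dualCoannihilator_dualAnnihilator_eq
  have hIJ : I = J.map e.symm.toLinearMap := by
    ext a
    simp [J]
  rcases hsimple P
    (fun h d hd => (hP _).2 fun a ha => (hP d).1 hd _ (hI h a ha))
    (fun d hd => mem_map₂_of_mem_map₂
      (mem_map₂_of_forall_dual fun ξ => (hP _).2 fun a ha =>
        (convMul_apply_eq_left a (toConv ξ) d).symm.trans ((hP d).1 hd _ (hr _ a ha)))
      (mem_map₂_top_of_forall_dual fun ξ => (hP _).2 fun a ha =>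
        (convMul_apply_eq_right (toConv ξ) a d).symm.trans ((hP d).1 hd _ (hl _ a ha)))) with h0 | h0
  · right
    rw [hIJ, ← hJ, h0, Submodule.dualAnnihilator_bot]
    simp
  · left
    rw [hIJ, ← hJ, h0, Submodule.dualAnnihilator_top]
    simp

theorem finrank_mul_finrank_of_isCoopCoaction [FiniteDimensional K H] [FiniteDimensional K D]
    [Nontrivial D] {ad : H →ₐ[K] Module.End K D}
    (hcomul : ∀ h d, comul (R := K) (ad h d) = ∑ i ∈ (ℛ K h).index,
      TensorProduct.map (ad ((ℛ K h).right i)) (ad ((ℛ K h).left i)) (comul d))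
    (hcounit : ∀ h d, counit (R := K) (ad h d) = counit (R := K) h * counit (R := K) d)
    (hsimple : ∀ P : Submodule K D, (∀ h, ∀ d ∈ P, ad h d ∈ P) →
      (∀ d ∈ P, comul (R := K) d ∈ Submodule.map₂ (TensorProduct.mk K D D) P P) →
      P = ⊥ ∨ P = ⊤)
    {W V : Type} [AddCommGroup W] [Module K W] [FiniteDimensional K W]
    [AddCommGroup V] [Module K V] [FiniteDimensional K V]
    {ρW : W →ₗ[K] D ⊗[K] W} (hW : IsCoopCoaction ρW)
    {ρV : V →ₗ[K] D ⊗[K] V} (hV : IsCoopCoaction ρV)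
    (act : H →ₐ[K] Module.End K V)
    (hact : ∀ h v, ρV (act h v) = ∑ i ∈ (ℛ K h).index,
      TensorProduct.map (ad ((ℛ K h).left i)) (act ((ℛ K h).right i)) (ρV v))
    (S : Submodule K (W →ₗ[K] V))
    (hS : ∀ φ, φ ∈ S ↔ ∀ ζ w, φ (contract ρW ζ w) = contract ρV ζ (φ w)) :
    Module.finrank K S * Module.finrank K D = Module.finrank K V * Module.finrank K W := by
  let : Module (WithConv (D →ₗ[K] K)) W := Module.compHom _ hW.hom.toRingHom
  let : Module (WithConv (D →ₗ[K] K)) V := Module.compHom _ hV.hom.toRingHom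
  have smulW (a : WithConv (D →ₗ[K] K)) (w : W) : a • w = contract ρW a.ofConv w := rfl
  have smulV (a : WithConv (D →ₗ[K] K)) (v : V) : a • v = contract ρV a.ofConv v := rfl
  have : IsScalarTower K (WithConv (D →ₗ[K] K)) W :=
    ⟨fun c a x => LinearMap.congr_fun (map_smul hW.hom c a) x⟩
  have : IsScalarTower K (WithConv (D →ₗ[K] K)) V :=
    ⟨fun c a x => LinearMap.congr_fun (map_smul hV.hom c a) x⟩
  have e := WithConv.linearEquiv K (D →ₗ[K] K)
  have : FiniteDimensional K (WithConv (D →ₗ[K] K)) := Module.Finite.equiv e.symm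
  have hrank : Module.finrank K (WithConv (D →ₗ[K] K)) = Module.finrank K D :=
    e.finrank_eq.trans Subspace.dual_finrank_eq
  have key := finrank_linearMap_mul_finrank_of_isOpModuleAlgebra (W := W) (V := V)
    (isOpModuleAlgebra_dualAction hcomul hcounit)
    (fun I h1 h2 h3 => eq_bot_or_eq_top_of_dualAction_mem hsimple I h1 h2 h3) act
    (fun h a v => by
      rw [smulV, contract, LinearMap.comp_apply, LinearMap.comp_apply, hact]
      simp only [map_sum, smulV, contract, LinearMap.comp_apply, dualAction_apply]
      refine Finset.sum_congr rfl fun i _ => ?_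
      generalize ρV v = y
      induction y with
      | zero => simp
      | add x y hx hy => simp only [map_add, hx, hy]
      | tmul p q => simp)
  rw [hrank] at key
  rw [← key]
  congr 1
  let r := LinearMap.restrictScalarsₗ K (WithConv (D →ₗ[K] K)) W V K
  have hr : Function.Injective r := LinearMap.restrictScalars_injective K
  have hrange : LinearMap.range r = S := by
    ext φ
    rw [hS]
    constructor
    · rintro ⟨ψ, rfl⟩ ζ w
      exact ψ.map_smul (toConv ζ) w
    · intro h
      exact ⟨{ toFun := φ, map_add' := φ.map_add, map_smul' := fun a w => h a.ofConv w }, rfl⟩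
  rw [← hrange]
  exact LinearMap.finrank_range_of_inj hr

end CoopComodule

section RestrictedCoalgebra

open TensorProduct Coalgebra

variable {K H : Type} [Field K] [Ring H] [HopfAlgebra K H]

/-- A linear retraction of `H` onto a subspace. -/
noncomputable def subspaceProj (D : Submodule K H) : H →ₗ[K] D :=
  (LinearMap.exists_leftInverse_of_injective D.subtype D.ker_subtype).choose

@[simp] lemma subspaceProj_coe {D : Submodule K H} (d : D) : subspaceProj D d = d :=
  LinearMap.congr_fun
    (LinearMap.exists_leftInverse_of_injective D.subtype D.ker_subtype).choose_spec d

lemma coe_subspaceProj {D : Submodule K H} {d : H} (hd : d ∈ D) : (subspaceProj D d : H) = d :=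
  congrArg Subtype.val (subspaceProj_coe (⟨d, hd⟩ : D))

lemma map_subtype_map_subspaceProj {D : Submodule K H} {z : H ⊗[K] H}
    (hz : z ∈ Submodule.map₂ (TensorProduct.mk K H H) D D) :
    TensorProduct.map D.subtype D.subtype
      (TensorProduct.map (subspaceProj D) (subspaceProj D) z) = z := by
  refine (Submodule.map₂_le (r := LinearMap.eqLocus (TensorProduct.map D.subtype D.subtype ∘ₗ
    TensorProduct.map (subspaceProj D) (subspaceProj D)) LinearMap.id)).2
    (fun d hd e he => ?_) hz
  simp [coe_subspaceProj hd, coe_subspaceProj he]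

lemma rTensor_subtype_rTensor_subspaceProj {D : Submodule K H} {U : Type} [AddCommGroup U]
    [Module K U] {z : H ⊗[K] U} (hz : z ∈ Submodule.map₂ (TensorProduct.mk K H U) D ⊤) :
    LinearMap.rTensor U D.subtype (LinearMap.rTensor U (subspaceProj D) z) = z := by
  refine (Submodule.map₂_le (r := LinearMap.eqLocus (LinearMap.rTensor U D.subtype ∘ₗ
    LinearMap.rTensor U (subspaceProj D)) LinearMap.id)).2 (fun d hd e _ => ?_) hz
  simp [coe_subspaceProj hd]

/-- The restriction of `Δ_R` to a subspace. -/
noncomputable def restrictedDeltaR (R : H ⊗[K] H) (D : Submodule K H) : D →ₗ[K] D ⊗[K] D :=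
  TensorProduct.map (subspaceProj D) (subspaceProj D) ∘ₗ deltaR K H R ∘ₗ D.subtype

variable {R : H ⊗[K] H} {D : Submodule K H}

lemma map_subtype_restrictedDeltaR (hD : IsSubcoalgebraR K H R D) (d : D) :
    TensorProduct.map D.subtype D.subtype (restrictedDeltaR R D d) = deltaR K H R d :=
  map_subtype_map_subspaceProj (hD d d.2)

lemma restrictedDeltaR_coassoc (hD : IsSubcoalgebraR K H R D)
    (hE : D ≤ deltaRCoalgebraLocus K H R) (d : D) :
    TensorProduct.assoc K D D D
        (LinearMap.rTensor D (restrictedDeltaR R D) (restrictedDeltaR R D d)) =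
      LinearMap.lTensor D (restrictedDeltaR R D) (restrictedDeltaR R D d) := by
  let p := subspaceProj D
  have h₁ : ∀ y : D ⊗[K] D, TensorProduct.assoc K D D D
      (LinearMap.rTensor D (restrictedDeltaR R D) y) = TensorProduct.map p (TensorProduct.map p p)
        (TensorProduct.assoc K H H H (LinearMap.rTensor H (deltaR K H R)
          (TensorProduct.map D.subtype D.subtype y))) := by
    intro y
    induction y with
    | zero => simp
    | add u v hu hv => simp only [map_add, hu, hv]
    | tmul u v =>
      simp only [LinearMap.rTensor_tmul, map_tmul, restrictedDeltaR, LinearMap.comp_apply]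
      generalize deltaR K H R (D.subtype u) = w
      induction w with
      | zero => simp
      | add u v hu hv => simp only [map_add, add_tmul, hu, hv]
      | tmul a b => simp [p]
  have h₂ : ∀ y : D ⊗[K] D,
      LinearMap.lTensor D (restrictedDeltaR R D) y = TensorProduct.map p (TensorProduct.map p p)
        (LinearMap.lTensor H (deltaR K H R) (TensorProduct.map D.subtype D.subtype y)) := by
    intro y
    induction y with
    | zero => simp
    | add u v hu hv => simp only [map_add, hu, hv]
    | tmul u v => simp [restrictedDeltaR, p]
  rw [h₁, h₂, map_subtype_restrictedDeltaR hD, (mem_deltaRCoalgebraLocus.1 (hE d.2)).1]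

/-- The co-opposite of the coalgebra `(D, Δ_R)`. -/
noncomputable abbrev coopCoalgebra (hD : IsSubcoalgebraR K H R D)
    (hE : D ≤ deltaRCoalgebraLocus K H R) : Coalgebra K D where
  comul := (TensorProduct.comm K D D).toLinearMap ∘ₗ restrictedDeltaR R D
  counit := counit ∘ₗ D.subtype
  coassoc := by
    ext d
    let σ : D ⊗[K] (D ⊗[K] D) →ₗ[K] D ⊗[K] (D ⊗[K] D) :=
      (TensorProduct.assoc K D D D).toLinearMap ∘ₗ
        (TensorProduct.comm K D (D ⊗[K] D)).toLinearMap ∘ₗ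
          LinearMap.lTensor D (TensorProduct.comm K D D).toLinearMap
    have h₁ : ∀ y : D ⊗[K] D, TensorProduct.assoc K D D D (LinearMap.rTensor D
        ((TensorProduct.comm K D D).toLinearMap ∘ₗ restrictedDeltaR R D)
          (TensorProduct.comm K D D y)) = σ (LinearMap.lTensor D (restrictedDeltaR R D) y) := by
      intro y
      induction y with
      | zero => simp
      | add u v hu hv => simp only [map_add, hu, hv]
      | tmul u v => simp [σ]
    have h₂ : ∀ y : D ⊗[K] D, LinearMap.lTensor D
        ((TensorProduct.comm K D D).toLinearMap ∘ₗ restrictedDeltaR R D)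
          (TensorProduct.comm K D D y) =
        σ (TensorProduct.assoc K D D D (LinearMap.rTensor D (restrictedDeltaR R D) y)) := by
      intro y
      induction y with
      | zero => simp
      | add u v hu hv => simp only [map_add, hu, hv]
      | tmul u v =>
        simp only [comm_tmul, LinearMap.lTensor_tmul, LinearMap.rTensor_tmul, LinearMap.comp_apply]
        generalize restrictedDeltaR R D u = w
        induction w with
        | zero => simp
        | add u v hu hv => simp only [map_add, add_tmul, tmul_add, hu, hv]
        | tmul a b => simp [σ]
    simp only [LinearMap.comp_apply, LinearEquiv.coe_coe]
    rw [h₁, h₂, restrictedDeltaR_coassoc hD hE]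
  rTensor_counit_comp_comul := by
    ext d
    have h₁ : ∀ y : D ⊗[K] D, LinearMap.rTensor D (counit ∘ₗ D.subtype)
        (TensorProduct.comm K D D y) = 1 ⊗ₜ subspaceProj D (TensorProduct.rid K H
          (LinearMap.lTensor H counit (TensorProduct.map D.subtype D.subtype y))) := by
      intro y
      induction y with
      | zero => simp
      | add u v hu hv => simp only [map_add, tmul_add, hu, hv]
      | tmul u v => simp [smul_tmul']
    simp only [LinearMap.comp_apply, LinearEquiv.coe_coe]
    rw [h₁, map_subtype_restrictedDeltaR hD, (mem_deltaRCoalgebraLocus.1 (hE d.2)).2.2]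
    simp
  lTensor_counit_comp_comul := by
    ext d
    have h₁ : ∀ y : D ⊗[K] D, LinearMap.lTensor D (counit ∘ₗ D.subtype)
        (TensorProduct.comm K D D y) = subspaceProj D (TensorProduct.lid K H
          (LinearMap.rTensor H counit (TensorProduct.map D.subtype D.subtype y))) ⊗ₜ 1 := by
      intro y
      induction y with
      | zero => simp
      | add u v hu hv => simp only [map_add, add_tmul, hu, hv]
      | tmul u v => simp [smul_tmul]
    simp only [LinearMap.comp_apply, LinearEquiv.coe_coe]
    rw [h₁, map_subtype_restrictedDeltaR hD, (mem_deltaRCoalgebraLocus.1 (hE d.2)).2.1]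
    simp

/-- The adjoint action on an adjoint-stable subspace. -/
noncomputable def restrictedAdHom (hD : ∀ h : H, ∀ a ∈ D, adAct K H h a ∈ D) :
    H →ₐ[K] Module.End K D :=
  AlgHom.ofLinearMap
    { toFun := fun h => (adHom K H h).restrict (p := D) (q := D)
        fun a ha => by rw [adHom_apply]; exact hD h a ha
      map_add' := fun g h => by ext; simp
      map_smul' := fun c h => by ext; simp }
    (by ext; simp)
    (fun g h => by ext; simp)

@[simp] lemma coe_restrictedAdHom (hD : ∀ h : H, ∀ a ∈ D, adAct K H h a ∈ D) (h : H) (d : D) :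
    (restrictedAdHom hD h d : H) = adHom K H h d := rfl

lemma subspaceProj_adHom (hD : ∀ h : H, ∀ a ∈ D, adAct K H h a ∈ D) (h : H) (d : D) :
    subspaceProj D (adHom K H h d) = restrictedAdHom hD h d := by
  rw [← coe_restrictedAdHom hD, subspaceProj_coe]

lemma restrictedDeltaR_restrictedAdHom (hR : IsQuasiTriangular K H R)
    (hD : IsAdjointStableSubcoalgebra K H R D) (h : H) (d : D) :
    restrictedDeltaR R D (restrictedAdHom hD.1 h d) = ∑ i ∈ (ℛ K h).index,
      TensorProduct.map (restrictedAdHom hD.1 ((ℛ K h).left i))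
        (restrictedAdHom hD.1 ((ℛ K h).right i)) (restrictedDeltaR R D d) := by
  have h₁ : ∀ (x y : H) (z : D ⊗[K] D), TensorProduct.map (subspaceProj D) (subspaceProj D)
      (TensorProduct.map (adHom K H x) (adHom K H y)
        (TensorProduct.map D.subtype D.subtype z)) =
      TensorProduct.map (restrictedAdHom hD.1 x) (restrictedAdHom hD.1 y) z := by
    intro x y z
    induction z with
    | zero => simp
    | add u v hu hv => simp only [map_add, hu, hv]
    | tmul u v => simp [subspaceProj_adHom hD.1]
  simp only [← h₁, map_subtype_restrictedDeltaR hD.2, ← map_sum, ← deltaR_adHom hR]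
  rfl

end RestrictedCoalgebra

section Cotensor

open TensorProduct Coalgebra

variable {K H : Type} [Field K] [Ring H] [HopfAlgebra K H] {R : H ⊗[K] H} {D : Submodule K H}
  {U : Type} [AddCommGroup U] [Module K U]

lemma isCoopCoaction_rTensor_subspaceProj (hD : IsSubcoalgebraR K H R D)
    (hE : D ≤ deltaRCoalgebraLocus K H R) {ρ : U →ₗ[K] H ⊗[K] U}
    (hmem : ∀ u, ρ u ∈ Submodule.map₂ (TensorProduct.mk K H U) D ⊤)
    (hcounit : ∀ u, TensorProduct.lid K U (LinearMap.rTensor U (counit (R := K)) (ρ u)) = u)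
    (hcoassoc : (LinearMap.rTensor U (deltaR K H R)) ∘ₗ ρ =
      (TensorProduct.assoc K H H U).symm.toLinearMap ∘ₗ (LinearMap.lTensor H ρ) ∘ₗ ρ) :
    let _ := coopCoalgebra hD hE
    IsCoopCoaction (LinearMap.rTensor U (subspaceProj D) ∘ₗ ρ) := by
  let _ := coopCoalgebra hD hE
  have hcomul : ∀ d : D, comul (R := K) d = TensorProduct.comm K D D (restrictedDeltaR R D d) :=
    fun _ => rfl
  have hρ : ∀ u, LinearMap.rTensor U D.subtype (LinearMap.rTensor U (subspaceProj D) (ρ u)) = ρ u :=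
    fun u => rTensor_subtype_rTensor_subspaceProj (hmem u)
  let p := subspaceProj D
  let τ : H ⊗[K] (H ⊗[K] U) →ₗ[K] D ⊗[K] (D ⊗[K] U) :=
    TensorProduct.map p (LinearMap.rTensor U p) ∘ₗ (TensorProduct.leftComm K H H U).toLinearMap
  refine ⟨fun u => ?_, fun u => ?_⟩
  · have h₁ : ∀ z : D ⊗[K] U, TensorProduct.assoc K D D U (LinearMap.rTensor U comul z) =
        τ (TensorProduct.assoc K H H U (LinearMap.rTensor U (deltaR K H R)
          (LinearMap.rTensor U D.subtype z))) := by
      intro z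
      induction z with
      | zero => simp
      | add u v hu hv => simp only [map_add, hu, hv]
      | tmul d v =>
        simp only [LinearMap.rTensor_tmul, hcomul, restrictedDeltaR, LinearMap.comp_apply]
        generalize deltaR K H R (D.subtype d) = w
        induction w with
        | zero => simp
        | add u v hu hv => simp only [map_add, add_tmul, hu, hv]
        | tmul a b => simp [τ, p]
    have h₂ : ∀ z : D ⊗[K] U, TensorProduct.leftComm K D D U
        (LinearMap.lTensor D (LinearMap.rTensor U (subspaceProj D) ∘ₗ ρ) z) =
        τ (LinearMap.lTensor H ρ (LinearMap.rTensor U D.subtype z)) := by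
      intro z
      induction z with
      | zero => simp
      | add u v hu hv => simp only [map_add, hu, hv]
      | tmul d v =>
        simp only [LinearMap.rTensor_tmul, LinearMap.lTensor_tmul, LinearMap.comp_apply]
        generalize ρ v = w
        induction w with
        | zero => simp
        | add u v hu hv => simp only [map_add, tmul_add, hu, hv]
        | tmul a b => simp [τ, p]
    have h₃ := LinearMap.congr_fun hcoassoc u
    simp only [LinearMap.comp_apply, LinearEquiv.coe_coe, LinearEquiv.eq_symm_apply] at h₃
    rw [h₁, h₂, LinearMap.comp_apply (g := ρ), hρ, h₃]
  · have h₁ : ∀ z : D ⊗[K] U, LinearMap.rTensor U (counit (R := K) (A := D)) z =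
        LinearMap.rTensor U (counit (R := K) (A := H)) (LinearMap.rTensor U D.subtype z) := by
      intro z
      rw [← LinearMap.comp_apply, ← LinearMap.rTensor_comp]
      rfl
    rw [h₁, LinearMap.comp_apply (g := ρ), hρ, hcounit]

lemma contract_rTensor_subspaceProj (ρ : U →ₗ[K] H ⊗[K] U) (ζ : Module.Dual K D) :
    contract (LinearMap.rTensor U (subspaceProj D) ∘ₗ ρ) ζ = contract ρ (ζ ∘ₗ subspaceProj D) := by
  simp only [contract, LinearMap.rTensor_comp, LinearMap.comp_assoc]

lemma contract_eq_contract_rTensor_subspaceProj {ρ : U →ₗ[K] H ⊗[K] U}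
    (hmem : ∀ u, ρ u ∈ Submodule.map₂ (TensorProduct.mk K H U) D ⊤) (ζ : Module.Dual K H) :
    contract ρ ζ = contract (LinearMap.rTensor U (subspaceProj D) ∘ₗ ρ) (ζ ∘ₗ D.subtype) := by
  ext u
  simp only [contract, LinearMap.rTensor_comp, LinearMap.comp_apply,
    rTensor_subtype_rTensor_subspaceProj (hmem u)]

variable {W V : Type} [AddCommGroup W] [Module K W] [FiniteDimensional K W]
  [AddCommGroup V] [Module K V]

lemma mem_cotensor_iff [FiniteDimensional K H] {ρW : W →ₗ[K] H ⊗[K] W}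
    {ρV : V →ₗ[K] H ⊗[K] V} {ρstar : Module.Dual K W →ₗ[K] Module.Dual K W ⊗[K] H}
    (hρ : IsDualCoaction K H ρW ρstar) (z : Module.Dual K W ⊗[K] V) :
    z ∈ cotensor K H ρstar ρV ↔ ∀ (ζ : Module.Dual K H) (w : W),
      dualTensorHom K W V z (contract ρW ζ w) = contract ρV ζ (dualTensorHom K W V z w) := by
  let T : Module.Dual K H → (H ⊗[K] V) →ₗ[K] V := fun ζ =>
    (TensorProduct.lid K V).toLinearMap ∘ₗ LinearMap.rTensor V ζ
  have h₁ : ∀ (ζ : Module.Dual K H) (w : W), T ζ (dualTensorHom K W (H ⊗[K] V)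
      (TensorProduct.assoc K _ H V (LinearMap.rTensor V ρstar z)) w) =
      dualTensorHom K W V z (contract ρW ζ w) := by
    intro ζ w
    induction z with
    | zero => simp
    | add u v hu hv => simp only [map_add, LinearMap.add_apply, hu, hv]
    | tmul f v =>
      have h₂ : ∀ y : Module.Dual K W ⊗[K] H, T ζ (dualTensorHom K W (H ⊗[K] V)
          (TensorProduct.assoc K _ H V (y ⊗ₜ v)) w) =
          ζ (TensorProduct.lid K H (LinearMap.rTensor H (Module.Dual.eval K W w) y)) • v := by
        intro y
        induction y with
        | zero => simp
        | add u v hu hv =>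
          simp only [map_add, add_tmul, LinearMap.add_apply, hu, hv, add_smul]
        | tmul g h => simp [T, dualTensorHom_apply, smul_smul]
      have h₃ : ∀ y : H ⊗[K] W, ζ (TensorProduct.rid K H (LinearMap.lTensor H f y)) =
          f (TensorProduct.lid K W (LinearMap.rTensor W ζ y)) := by
        intro y
        induction y with
        | zero => simp
        | add u v hu hv => simp only [map_add, hu, hv]
        | tmul g h => simp [mul_comm]
      rw [LinearMap.rTensor_tmul, h₂, hρ, h₃, dualTensorHom_apply]
      rfl
  have h₂ : ∀ (ζ : Module.Dual K H) (w : W), T ζ (dualTensorHom K W (H ⊗[K] V)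
      (LinearMap.lTensor _ ρV z) w) = contract ρV ζ (dualTensorHom K W V z w) := by
    intro ζ w
    clear h₁
    induction z with
    | zero => simp
    | add u v hu hv => simp only [map_add, LinearMap.add_apply, hu, hv]
    | tmul f v => simp [T, contract, dualTensorHom_apply]
  simp only [← h₁, ← h₂]
  have h₃ : z ∈ cotensor K H ρstar ρV ↔ TensorProduct.assoc K _ H V (LinearMap.rTensor V ρstar z) =
      LinearMap.lTensor _ ρV z := by
    rw [cotensor, LinearMap.mem_ker]
    exact sub_eq_zero (a := TensorProduct.assoc K _ H V (LinearMap.rTensor V ρstar z))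
      (b := LinearMap.lTensor _ ρV z)
  rw [h₃]
  refine ⟨fun h ζ w => by rw [h], fun h => ?_⟩
  refine (dualTensorHomEquiv K W (H ⊗[K] V)).injective (LinearMap.ext fun w => ?_)
  simp only [dualTensorHomEquiv, LinearEquiv.ofBijective_apply]
  rw [← sum_tmul_rTensor_coord (Module.finBasis K H) (dualTensorHom K W (H ⊗[K] V)
      (TensorProduct.assoc K _ H V (LinearMap.rTensor V ρstar z)) w),
    ← sum_tmul_rTensor_coord (Module.finBasis K H) (dualTensorHom K W (H ⊗[K] V)
      (LinearMap.lTensor _ ρV z) w)]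
  exact Finset.sum_congr rfl fun i _ => congrArg _ (h _ w)

theorem finrank_cotensor_mul_finrank [FiniteDimensional K H] (hR : IsQuasiTriangular K H R)
    (hD : IsMinimalAdjointStableSubcoalgebra K H R D) [Nontrivial W] (sW : DComodStr K H R D W)
    {ρstar : Module.Dual K W →ₗ[K] Module.Dual K W ⊗[K] H}
    (hρ : IsDualCoaction K H sW.coact ρstar) [FiniteDimensional K V] (t : RModStr K H R V)
    (ht : memDCat K H R D t) :
    Module.finrank K (cotensor K H ρstar t.coact) * Module.finrank K D =
      Module.finrank K V * Module.finrank K W := by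
  have hE : D ≤ deltaRCoalgebraLocus K H R := sW.le_deltaRCoalgebraLocus hR hD
  obtain ⟨hne, hst, hmin⟩ := hD
  let _ := coopCoalgebra hst.2 hE
  have hcomul : ∀ d : D, comul (R := K) d = TensorProduct.comm K D D (restrictedDeltaR R D d) :=
    fun _ => rfl
  have : Nontrivial D := Submodule.nontrivial_iff_ne_bot.2 hne
  have hcomm : ∀ (x y : H) (z : D ⊗[K] D), TensorProduct.comm K D D (TensorProduct.map
      (restrictedAdHom hst.1 x) (restrictedAdHom hst.1 y) z) = TensorProduct.map
      (restrictedAdHom hst.1 y) (restrictedAdHom hst.1 x) (TensorProduct.comm K D D z) := by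
    intro x y z
    induction z with
    | zero => simp
    | add u v hu hv => simp only [map_add, hu, hv]
    | tmul u v => simp
  have hfin : Module.finrank K ((cotensor K H ρstar t.coact).map
      (dualTensorHomEquiv K W V).toLinearMap) = Module.finrank K (cotensor K H ρstar t.coact) :=
    LinearEquiv.finrank_map_eq (dualTensorHomEquiv K W V) _
  rw [← hfin]
  refine finrank_mul_finrank_of_isCoopCoaction (ad := restrictedAdHom hst.1) ?_ ?_ ?_
    (isCoopCoaction_rTensor_subspaceProj hst.2 hE sW.mem sW.counit_coact sW.coassocR)
    (isCoopCoaction_rTensor_subspaceProj hst.2 hE ht t.counit_coact t.coassocR) t.act ?_ _ ?_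
  · intro h d
    simp only [hcomul, restrictedDeltaR_restrictedAdHom hR hst, map_sum, hcomm]
  · intro h d
    exact counit_adHom h (d : H)
  · intro P hP hPc
    have key : P.map D.subtype = ⊥ ∨ P.map D.subtype = D := by
      refine hmin _ (Submodule.map_subtype_le D P) ⟨?_, ?_⟩
      · rintro h _ ⟨d, hd, rfl⟩
        exact ⟨restrictedAdHom hst.1 h d, hP h d hd, adHom_apply h (d : H)⟩
      · rintro _ ⟨d, hd, rfl⟩
        have h₁ : deltaR K H R d = TensorProduct.comm K H H
            (TensorProduct.map D.subtype D.subtype (comul (R := K) d)) := by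
          rw [← map_subtype_restrictedDeltaR hst.2, hcomul]
          generalize restrictedDeltaR R D d = z
          induction z with
          | zero => simp
          | add u v hu hv => simp only [map_add, hu, hv]
          | tmul u v => simp
        rw [Submodule.subtype_apply, h₁]
        refine (Submodule.map₂_le (r := (Submodule.map₂ (TensorProduct.mk K H H)
          (P.map D.subtype) (P.map D.subtype)).comap ((TensorProduct.comm K H H).toLinearMap ∘ₗ
            TensorProduct.map D.subtype D.subtype))).2 (fun x hx y hy => ?_) (hPc d hd)
        exact Submodule.apply_mem_map₂ (TensorProduct.mk K H H)
          (Submodule.mem_map_of_mem hy) (Submodule.mem_map_of_mem hx)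
    refine key.imp (fun h => ?_) (fun h => ?_)
    · exact Submodule.map_injective_of_injective D.subtype_injective
        (h.trans (Submodule.map_bot _).symm)
    · exact Submodule.map_injective_of_injective D.subtype_injective
        (h.trans (D.map_subtype_top).symm)
  · intro h v
    have h₁ := LinearMap.congr_fun t.compat (h ⊗ₜ v)
    simp only [LinearMap.comp_apply, lift.tmul, map_tmul, LinearEquiv.coe_coe,
      AlgHom.toLinearMap_apply] at h₁
    rw [LinearMap.comp_apply, h₁, LinearMap.comp_apply]
    conv_lhs => rw [← rTensor_subtype_rTensor_subspaceProj (ht v), ← (ℛ K h).eq]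
    generalize LinearMap.rTensor V (subspaceProj D) (t.coact v) = z
    simp only [sum_tmul, map_sum]
    refine Finset.sum_congr rfl fun i _ => ?_
    induction z with
    | zero => simp
    | add u v hu hv => simp only [map_add, tmul_add, hu, hv]
    | tmul d u => simp [← adHom_apply, subspaceProj_adHom hst.1]
  · intro φ
    obtain ⟨z, rfl⟩ := (dualTensorHomEquiv K W V).surjective φ
    have h₁ : dualTensorHomEquiv K W V z ∈ (cotensor K H ρstar t.coact).map
        (dualTensorHomEquiv K W V).toLinearMap ↔ z ∈ cotensor K H ρstar t.coact :=
      by simp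
    rw [h₁, mem_cotensor_iff hρ]
    refine ⟨fun h ζ w => ?_, fun h ζ w => ?_⟩
    · simp only [contract_rTensor_subspaceProj]
      exact h _ w
    · rw [contract_eq_contract_rTensor_subspaceProj sW.mem,
        contract_eq_contract_rTensor_subspaceProj ht]
      exact h _ w

end Cotensor

section FreeObject

open TensorProduct Coalgebra

variable {K H : Type} [Field K] [Ring H] [HopfAlgebra K H] {R : H ⊗[K] H} {D : Submodule K H}
  {U : Type} [AddCommGroup U] [Module K U]

lemma rhoHW_tmul (sU : DComodStr K H R D U) (h : H) (u : U) :
    rhoHW K H R sU (h ⊗ₜ u) = ∑ i ∈ (ℛ K h).index,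
      TensorProduct.map (adHom K H ((ℛ K h).left i)) (TensorProduct.mk K H U ((ℛ K h).right i))
        (sU.coact u) := by
  simp only [rhoHW, LinearMap.comp_apply, map_tmul, LinearEquiv.coe_coe]
  generalize sU.coact u = z
  conv_lhs => rw [← (ℛ K h).eq]
  simp only [sum_tmul, map_sum]
  refine Finset.sum_congr rfl fun i _ => ?_
  induction z with
  | zero => simp
  | add u v hu hv => simp only [map_add, tmul_add, hu, hv]
  | tmul d u => simp [adHom_apply]

lemma counit_rhoHW (sU : DComodStr K H R D U) (v : H ⊗[K] U) :
    TensorProduct.lid K (H ⊗[K] U)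
      (LinearMap.rTensor (H ⊗[K] U) (counit (R := K)) (rhoHW K H R sU v)) = v := by
  have h₁ : ∀ (x y : H) (z : H ⊗[K] U), TensorProduct.lid K (H ⊗[K] U)
      (LinearMap.rTensor (H ⊗[K] U) (counit (R := K))
        (TensorProduct.map (adHom K H x) (TensorProduct.mk K H U y) z)) =
      (counit (R := K) x • y) ⊗ₜ
        TensorProduct.lid K U (LinearMap.rTensor U (counit (R := K)) z) := by
    intro x y z
    induction z with
    | zero => simp
    | add u v hu hv => simp only [map_add, tmul_add, hu, hv]
    | tmul a u => simp [counit_adHom, smul_smul, smul_tmul', mul_comm]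
  induction v with
  | zero => simp
  | add u v hu hv => simp only [map_add, hu, hv]
  | tmul h u =>
    simp only [rhoHW_tmul, map_sum, h₁, sU.counit_coact]
    rw [← sum_tmul, sum_counit_smul]

lemma rhoHW_coassoc (hR : IsQuasiTriangular K H R) (sU : DComodStr K H R D U) :
    LinearMap.rTensor (H ⊗[K] U) (deltaR K H R) ∘ₗ rhoHW K H R sU =
      (TensorProduct.assoc K H H (H ⊗[K] U)).symm.toLinearMap ∘ₗ
        LinearMap.lTensor H (rhoHW K H R sU) ∘ₗ rhoHW K H R sU := by
  have h₁ : ∀ (x y : H) (z : H ⊗[K] U), LinearMap.rTensor (H ⊗[K] U) (deltaR K H R)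
      (TensorProduct.map (adHom K H x) (TensorProduct.mk K H U y) z) =
      ∑ j ∈ (ℛ K x).index, TensorProduct.map (TensorProduct.map (adHom K H ((ℛ K x).left j))
        (adHom K H ((ℛ K x).right j))) (TensorProduct.mk K H U y)
          (LinearMap.rTensor U (deltaR K H R) z) := by
    intro x y z
    induction z with
    | zero => simp
    | add u v hu hv => simp only [map_add, hu, hv, Finset.sum_add_distrib]
    | tmul a u => simp only [map_tmul, LinearMap.rTensor_tmul, deltaR_adHom hR x a, sum_tmul]
  have h₂ : ∀ (x y : H) (z : H ⊗[K] U), (TensorProduct.assoc K H H (H ⊗[K] U)).symm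
      (LinearMap.lTensor H (rhoHW K H R sU)
        (TensorProduct.map (adHom K H x) (TensorProduct.mk K H U y) z)) =
      ∑ j ∈ (ℛ K y).index, TensorProduct.map (TensorProduct.map (adHom K H x)
        (adHom K H ((ℛ K y).left j))) (TensorProduct.mk K H U ((ℛ K y).right j))
          ((TensorProduct.assoc K H H U).symm (LinearMap.lTensor H sU.coact z)) := by
    intro x y z
    induction z with
    | zero => simp
    | add u v hu hv => simp only [map_add, hu, hv, Finset.sum_add_distrib]
    | tmul a u =>
      simp only [map_tmul, LinearMap.lTensor_tmul, mk_apply, rhoHW_tmul, tmul_sum, map_sum]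
      refine Finset.sum_congr rfl fun j _ => ?_
      generalize sU.coact u = w
      induction w with
      | zero => simp
      | add u v hu hv => simp only [map_add, tmul_add, hu, hv]
      | tmul p q => simp
  refine TensorProduct.ext' fun h u => ?_
  have h₃ := LinearMap.congr_fun sU.coassocR u
  simp only [LinearMap.comp_apply, LinearEquiv.coe_coe] at h₃
  simp only [LinearMap.comp_apply, LinearEquiv.coe_coe, rhoHW_tmul, map_sum, h₁, h₂, ← h₃]
  generalize LinearMap.rTensor U (deltaR K H R) (sU.coact u) = Y
  exact sum_coassoc_of_trilinear
    (fun x y z => TensorProduct.map (TensorProduct.map (adHom K H x) (adHom K H y))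
      (TensorProduct.mk K H U z) Y)
    (fun b c => ⟨by simp [map_add_left], by simp [map_smul_left]⟩)
    (fun a c => ⟨by simp [map_add_left, map_add_right], by simp [map_smul_left, map_smul_right]⟩)
    (fun a b => ⟨by simp [map_add_right], by simp [map_smul_right]⟩) h (ℛ K h)
    (fun _ => ℛ K _) (fun _ => ℛ K _)

/-- The free object `H ⊗ U` of `_H^{H_R}M` on a comodule `U`. -/
noncomputable def freeRModStr (hR : IsQuasiTriangular K H R) (sU : DComodStr K H R D U) :
    RModStr K H R (H ⊗[K] U) where
  act := (Module.End.rTensorAlgHom K H U).comp (Algebra.lmul K H)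
  coact := rhoHW K H R sU
  counit_coact := counit_rhoHW sU
  coassocR := rhoHW_coassoc hR sU
  compat := by
    have hact : ∀ (h g : H) (u : U), (Module.End.rTensorAlgHom K H U).comp (Algebra.lmul K H) h
        (g ⊗ₜ u) = (h * g) ⊗ₜ u := fun _ _ _ => rfl
    refine TensorProduct.ext' fun h v => ?_
    induction v with
    | zero => simp
    | add u v hu hv => simp only [tmul_add, map_add, hu, hv]
    | tmul g u =>
      simp only [rhoHW, LinearMap.comp_apply, lift.tmul, map_tmul, LinearEquiv.coe_coe,
        AlgHom.toLinearMap_apply, hact, Bialgebra.comul_mul]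
      generalize comul (R := K) h = x
      generalize comul (R := K) g = y
      generalize sU.coact u = z
      induction x with
      | zero => simp
      | add x₁ x₂ h₁ h₂ => simp only [add_mul, add_tmul, map_add, h₁, h₂]
      | tmul a b =>
        induction y with
        | zero => simp
        | add x₁ x₂ h₁ h₂ => simp only [mul_add, add_tmul, tmul_add, map_add, h₁, h₂]
        | tmul c d =>
          induction z with
          | zero => simp
          | add x₁ x₂ h₁ h₂ => simp only [tmul_add, map_add, h₁, h₂]
          | tmul p q =>
            simp only [Algebra.TensorProduct.tmul_mul_tmul, tensorTensorTensorComm_tmul, map_tmul,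
              lift.tmul, AlgHom.toLinearMap_apply, hact, ← adHom_apply, map_mul, Module.End.mul_apply,
              LinearMap.id_apply]

lemma memDCat_freeRModStr (hR : IsQuasiTriangular K H R)
    (hD : ∀ h : H, ∀ a ∈ D, adAct K H h a ∈ D) (sU : DComodStr K H R D U) :
    memDCat K H R D (freeRModStr hR sU) := by
  intro v
  change rhoHW K H R sU v ∈ Submodule.map₂ (TensorProduct.mk K H (H ⊗[K] U)) D ⊤
  induction v with
  | zero => simp
  | add u v hu hv => rw [map_add]; exact Submodule.add_mem _ hu hv
  | tmul h u =>
    rw [rhoHW_tmul]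
    refine Submodule.sum_mem _ fun i _ => ?_
    refine (Submodule.map₂_le (r := (Submodule.map₂ (TensorProduct.mk K H (H ⊗[K] U)) D ⊤).comap
      (TensorProduct.map (adHom K H ((ℛ K h).left i))
        (TensorProduct.mk K H U ((ℛ K h).right i))))).2 (fun d hd u _ => ?_) (sU.mem u)
    refine Submodule.apply_mem_map₂ (TensorProduct.mk K H (H ⊗[K] U)) ?_ Submodule.mem_top
    rw [adHom_apply]
    exact hD _ d hd

end FreeObject

set_option synthInstance.maxHeartbeats 1000000 in
set_option maxHeartbeats 1000000 in
/-- **Statement 18.** Let `(H,R)` be a finite dimensional semisimple and cosemisimple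
quasi-triangular Hopf algebra, `D` a minimal `H`-adjoint-stable subcoalgebra of `H_R`
and `W` a finite dimensional nonzero left `D`-comodule.  Then for every finite
dimensional `V ∈ _H^D M` one has `dim (W* □_D V) · dim D = dim V · dim W`; in
particular `dim N_{W W'} · dim D = dim H · dim W · dim W'` for finite dimensional left
`D`-comodules `W, W'`, where `N_{W W'} = W* □_D (H ⊗ W')`. -/
theorem cotensor_dimension_formula
    [FiniteDimensional K H] (R : H ⊗[K] H) (hR : IsQuasiTriangular K H R)
    (hss : IsSemisimpleRing H) (hcoss : IsCosemisimpleCoalgebra K H)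
    (D : Submodule K H) (hD : IsMinimalAdjointStableSubcoalgebra K H R D)
    (W : Type) [AddCommGroup W] [Module K W] [FiniteDimensional K W] [Nontrivial W]
    (sW : DComodStr K H R D W)
    (ρstar : (W →ₗ[K] K) →ₗ[K] (W →ₗ[K] K) ⊗[K] H)
    (hρstar : IsDualCoaction K H sW.coact ρstar) :
    (∀ (V : Type) [AddCommGroup V] [Module K V] [FiniteDimensional K V]
        (t : RModStr K H R V), memDCat K H R D t →
        Module.finrank K ↥(cotensor K H ρstar t.coact) * Module.finrank K ↥D
          = Module.finrank K V * Module.finrank K W) ∧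
    (∀ (W' : Type) [AddCommGroup W'] [Module K W'] [FiniteDimensional K W']
        (sW' : DComodStr K H R D W'),
        Module.finrank K ↥(cotensor K H ρstar (rhoHW K H R sW')) * Module.finrank K ↥D
          = Module.finrank K H * Module.finrank K W * Module.finrank K W') := by
  refine ⟨fun V _ _ _ t ht => finrank_cotensor_mul_finrank hR hD sW hρstar t ht,
    fun W' _ _ _ sW' => ?_⟩
  have h := finrank_cotensor_mul_finrank hR hD sW hρstar (freeRModStr hR sW')
    (memDCat_freeRModStr hR hD.2.1.1 sW')
  rw [Module.finrank_tensorProduct, mul_right_comm] at h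
  exact h
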